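/- arXiv:1406.6531 — 2 statements merged into one kernel-verified Lean document; each statement's English description precedes it below -/
import Mathlib

section
/- Hamilton cycles in robust outexpanders (Kühn–Osthus–Treglown): For every η ∈ (0,1) there exists τ₀ > 0 such that for every τ ∈ (0, τ₀] and every ν ∈ (0, τ] there exists an integer n₀ so that the following holds. Every digraph G on n ≥ n₀ vertices with δ⁰(G) ≥ ηn that is a robust (ν, τ)-outexpander contains a directed Hamilton cycle. -/
open Finset
open scoped Classical

/-- The out-degree of a vertex in a digraph given by its edge relation. -/
noncomputable def outDeg {V : Type*} [Fintype V] (G : V → V → Prop) (x : V) : ℕ :=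
  (Finset.univ.filter fun y => G x y).card

/-- The in-degree of a vertex in a digraph given by its edge relation. -/
noncomputable def inDeg {V : Type*} [Fintype V] (G : V → V → Prop) (x : V) : ℕ :=
  (Finset.univ.filter fun y => G y x).card

/-- The `ν`-robust outneighbourhood of `S`: all vertices with at least `νn`
in-neighbours in `S`. -/
noncomputable def robustOutNbhd {V : Type*} [Fintype V] (G : V → V → Prop) (ν : ℝ)
    (S : Finset V) : Finset V :=
  Finset.univ.filter fun v => ν * (Fintype.card V : ℝ) ≤ ((S.filter fun s => G s v).card : ℝ)

/-- The `ν`-robust inneighbourhood of `S`: all vertices with at least `νn`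
out-neighbours in `S`. -/
noncomputable def robustInNbhd {V : Type*} [Fintype V] (G : V → V → Prop) (ν : ℝ)
    (S : Finset V) : Finset V :=
  Finset.univ.filter fun v => ν * (Fintype.card V : ℝ) ≤ ((S.filter fun s => G v s).card : ℝ)

/-- `G` is a robust `(ν,τ)`-outexpander. -/
def RobustOutexpander {V : Type*} [Fintype V] (G : V → V → Prop) (ν τ : ℝ) : Prop :=
  ∀ S : Finset V, τ * (Fintype.card V : ℝ) < (S.card : ℝ) →
    (S.card : ℝ) < (1 - τ) * (Fintype.card V : ℝ) →
    (S.card : ℝ) + ν * (Fintype.card V : ℝ) ≤ ((robustOutNbhd G ν S).card : ℝ)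

/-- `G` is a robust `(ν,τ)`-inexpander. -/
def RobustInexpander {V : Type*} [Fintype V] (G : V → V → Prop) (ν τ : ℝ) : Prop :=
  ∀ S : Finset V, τ * (Fintype.card V : ℝ) < (S.card : ℝ) →
    (S.card : ℝ) < (1 - τ) * (Fintype.card V : ℝ) →
    (S.card : ℝ) + ν * (Fintype.card V : ℝ) ≤ ((robustInNbhd G ν S).card : ℝ)

/-- A directed Hamilton cycle in the digraph `G`: a cyclic ordering of all the
vertices such that consecutive vertices are joined by a directed edge. -/
def HasDiHamCycle {V : Type*} [Fintype V] (G : V → V → Prop) : Prop :=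
  ∃ e : ZMod (Fintype.card V) ≃ V, ∀ i, G (e i) (e (i + 1))

/-- `l` lists the vertices of a directed walk in `G` from `a` to `b`. -/
def DiPath {V : Type*} (G : V → V → Prop) (a b : V) (l : List V) : Prop :=
  l.IsChain G ∧ l.head? = some a ∧ l.getLast? = some b

/-- The vertices of `l`, in this order, lead from `a` to `b` along edges of `G`. -/
def Link {V : Type*} (G : V → V → Prop) (a : V) (l : List V) (b : V) : Prop :=
  (a :: (l ++ [b])).IsChain G

section Paths

variable {V : Type*} {G : V → V → Prop}

lemma DiPath.singleton (a : V) : DiPath G a a [a] := by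
  simp [DiPath]

lemma DiPath.append {a b c d : V} {l l' : List V} (h : DiPath G a b l) (e : G b c)
    (h' : DiPath G c d l') : DiPath G a d (l ++ l') := by
  obtain ⟨h1, h2, h3⟩ := h
  obtain ⟨h1', h2', h3'⟩ := h'
  refine ⟨List.isChain_append.2 ⟨h1, h1', ?_⟩, ?_, ?_⟩
  · simp [h3, h2', e]
  · simp [List.head?_append, h2]
  · simp [List.getLast?_append, h3']

lemma DiPath.cons {a c d : V} {l : List V} (e : G a c) (h : DiPath G c d l) :
    DiPath G a d (a :: l) :=
  (DiPath.singleton a).append e h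

lemma Link.diPath {a b : V} {l : List V} (h : Link G a l b) : DiPath G a b (a :: (l ++ [b])) :=
  ⟨h, by simp, by simp [List.getLast?_cons, List.getLast?_append]⟩

lemma DiPath.link {a b c d : V} {l l' m : List V} (h : DiPath G a b l) (e : Link G b m c)
    (h' : DiPath G c d l') : DiPath G a d (l ++ (m ++ l')) := by
  induction m generalizing a b l with
  | nil => exact h.append (by simpa [Link] using e) h'
  | cons x m ih =>
    have e' : G b x ∧ Link G x m c := by simpa [Link] using e
    simpa using ih (h.append e'.1 (DiPath.singleton x)) e'.2

lemma DiPath.cons_link {a b c : V} {l m : List V} (e : Link G a m b)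
    (h : DiPath G b c l) : DiPath G a c (a :: (m ++ l)) :=
  (DiPath.singleton a).link e h

end Paths

/-- A robust outexpander of linear minimum semidegree, with compatible parameters. -/
structure RobustDigraph {V : Type*} [Fintype V] (G : V → V → Prop) (η ν τ : ℝ) : Prop where
  nu_pos : 0 < ν
  nu_le : ν ≤ τ
  add_le : τ + ν ≤ η
  le_outDeg : ∀ v, η * (Fintype.card V : ℝ) ≤ (outDeg G v : ℝ)
  le_inDeg : ∀ v, η * (Fintype.card V : ℝ) ≤ (inDeg G v : ℝ)
  expands : RobustOutexpander G ν τ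

section Robust

variable {V : Type*} [Fintype V] {G : V → V → Prop} {η ν τ : ℝ}

lemma RobustDigraph.comp_perm (h : RobustDigraph G η ν τ) (σ : Equiv.Perm V) :
    RobustDigraph (fun x y => G x (σ y)) η ν τ where
  nu_pos := h.nu_pos
  nu_le := h.nu_le
  add_le := h.add_le
  le_outDeg v := by
    refine (h.le_outDeg v).trans (le_of_eq ?_)
    unfold outDeg
    congr 1
    exact (Finset.card_equiv σ (by simp)).symm
  le_inDeg v := h.le_inDeg (σ v)
  expands S h1 h2 := by
    refine (h.expands S h1 h2).trans (le_of_eq ?_)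
    unfold robustOutNbhd
    congr 1
    exact (Finset.card_equiv σ (by simp)).symm

/-- The vertices reached by robust expansion after `j + 1` steps starting from `b`. -/
noncomputable def robustReach (G : V → V → Prop) (ν : ℝ) (b : V) : ℕ → Finset V
  | 0 => Finset.univ.filter fun y => G b y
  | j + 1 => robustOutNbhd G ν (robustReach G ν b j)

lemma RobustDigraph.robustOutNbhd_eq_univ (h : RobustDigraph G η ν τ) {S : Finset V}
    (hS : (1 - τ) * (Fintype.card V : ℝ) ≤ S.card) : robustOutNbhd G ν S = Finset.univ := by
  ext v
  simp only [robustOutNbhd, Finset.mem_filter, Finset.mem_univ, true_and, iff_true]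
  have h1 := h.le_inDeg v
  have h2 : inDeg G v ≤ (S.filter fun s => G s v).card + Sᶜ.card := by
    unfold inDeg
    refine (Finset.card_le_card ?_).trans (Finset.card_union_le _ _)
    intro x hx
    by_cases hxS : x ∈ S <;> simp_all
  have h3 : (S.card : ℝ) + Sᶜ.card = Fintype.card V := by
    exact_mod_cast Finset.card_add_card_compl S
  have h4 : (inDeg G v : ℝ) ≤ (S.filter fun s => G s v).card + Sᶜ.card := by exact_mod_cast h2
  have h5 := mul_le_mul_of_nonneg_right h.add_le (Nat.cast_nonneg (α := ℝ) (Fintype.card V))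
  nlinarith

lemma RobustDigraph.le_card_robustReach (h : RobustDigraph G η ν τ) (b : V) (j : ℕ) :
    (1 - τ) * (Fintype.card V : ℝ) ≤ (robustReach G ν b j).card ∨
      (η + j * ν) * (Fintype.card V : ℝ) ≤ (robustReach G ν b j).card := by
  have hn : (0 : ℝ) < Fintype.card V := by
    exact_mod_cast Fintype.card_pos_iff.2 ⟨b⟩
  have h1 := h.nu_pos
  have h2 := h.nu_le
  have h3 := h.add_le
  induction j with
  | zero => right; simpa [robustReach, outDeg] using h.le_outDeg b
  | succ j ih =>
    by_cases hc : (1 - τ) * (Fintype.card V : ℝ) ≤ (robustReach G ν b j).card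
    · left
      rw [robustReach, h.robustOutNbhd_eq_univ hc, Finset.card_univ]
      nlinarith
    · right
      have ih := ih.resolve_left hc
      have hj : (0 : ℝ) ≤ j * ν := by positivity
      have := h.expands _ (lt_of_lt_of_le (mul_lt_mul_of_pos_right (by linarith) hn) ih)
        (not_le.1 hc)
      rw [robustReach]
      push_cast
      linarith

lemma exists_link_of_mem_robustReach {C : V → V → Prop} {q : ℕ}
    (hC : ∀ x, (Finset.univ.filter fun y => C x y).card ≤ q) {b : V} (m : ℕ) :
    ∀ {y : V} {X : Finset V}, y ∈ robustReach G ν b m →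
      (X.card : ℝ) + m * q < ν * Fintype.card V →
      ∃ l : List V, l.length = m ∧ Link G b l y ∧ (∀ x ∈ l, x ∉ X) ∧
        l.Pairwise fun x y => ¬ C y x := by
  induction m with
  | zero =>
    intro y X hy _
    exact ⟨[], rfl, by simpa [robustReach, Link] using hy, by simp, by simp⟩
  | succ m ih =>
    intro y X hy hX
    simp only [robustReach, robustOutNbhd, Finset.mem_filter, Finset.mem_univ, true_and] at hy
    push_cast at hX
    have hlt : X.card < ((robustReach G ν b m).filter fun s => G s y).card := by
      have : (0 : ℝ) ≤ (m + 1) * q := by positivity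
      exact_mod_cast (show (X.card : ℝ) < ((robustReach G ν b m).filter fun s => G s y).card by
        linarith)
    obtain ⟨z, hz, hzX⟩ := Finset.exists_mem_notMem_of_card_lt_card hlt
    simp only [Finset.mem_filter] at hz
    obtain ⟨l, hl, hlink, hav, hp⟩ := ih (X := X ∪ Finset.univ.filter fun x => C z x) hz.1 (by
      have h1 := (Finset.card_union_le X (Finset.univ.filter fun x => C z x)).trans
        (Nat.add_le_add_left (hC z) _)
      have h2 : ((X ∪ Finset.univ.filter fun x => C z x).card : ℝ) ≤ X.card + q := by
        exact_mod_cast h1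
      linarith)
    refine ⟨l ++ [z], by simp [hl], ?_, ?_, ?_⟩
    · simpa [Link] using
        (hlink.diPath.append hz.2 (DiPath.singleton y)).1
    · intro x hx
      rcases List.mem_append.1 hx with hx | hx
      · exact fun h => hav x hx (Finset.mem_union_left _ h)
      · rw [List.mem_singleton.1 hx]
        exact hzX
    · rw [List.pairwise_append]
      refine ⟨hp, by simp, fun a ha c hc => ?_⟩
      rw [List.mem_singleton.1 hc]
      intro h
      exact hav a ha (by simp [h])

/-- Any two vertices of a robust digraph are joined by a path with a prescribed, sufficiently
large number `m` of inner vertices which avoid `X` and are pairwise not in conflict. -/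
lemma RobustDigraph.exists_link (h : RobustDigraph G η ν τ) {C : V → V → Prop} {q : ℕ}
    (hC : ∀ x, (Finset.univ.filter fun y => C x y).card ≤ q) {m : ℕ} (hm : 1 ≤ m * ν)
    (b b' : V) {X : Finset V} (hX : (X.card : ℝ) + m * q < ν * Fintype.card V) :
    ∃ l : List V, l.length = m ∧ Link G b l b' ∧ (∀ x ∈ l, x ∉ X) ∧
      l.Pairwise fun x y => ¬ C y x := by
  refine exists_link_of_mem_robustReach hC m ?_ hX
  have hn : (0 : ℝ) < Fintype.card V := by
    exact_mod_cast Fintype.card_pos_iff.2 ⟨b⟩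
  obtain ⟨k, rfl⟩ : ∃ k, m = k + 1 := by
    refine Nat.exists_eq_succ_of_ne_zero ?_
    rintro rfl
    norm_num at hm
  rw [robustReach, h.robustOutNbhd_eq_univ]
  · exact Finset.mem_univ _
  · have h1 := h.nu_pos
    have h2 := h.nu_le
    have h3 := h.add_le
    refine (h.le_card_robustReach b k).resolve_right fun hc => ?_
    have h4 : ((robustReach G ν b k).card : ℝ) ≤ Fintype.card V := by
      exact_mod_cast Finset.card_le_univ _
    push_cast at hm
    nlinarith

lemma RobustDigraph.exists_nodup_link (h : RobustDigraph G η ν τ) {m : ℕ} (hm : 1 ≤ m * ν)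
    (b b' : V) {X : Finset V} (hX : (X.card : ℝ) + m < ν * Fintype.card V) :
    ∃ l : List V, l.length = m ∧ Link G b l b' ∧ (∀ x ∈ l, x ∉ X) ∧ l.Nodup := by
  obtain ⟨l, h1, h2, h3, h4⟩ := h.exists_link (C := Eq) (q := 1)
    (fun x => by simp [Finset.filter_eq]) hm b b' (X := X) (by simpa using hX)
  exact ⟨l, h1, h2, h3, h4.imp fun h e => h e.symm⟩

end Robust

section Absorb

variable {V : Type*}

/-- The path `B` from `a` to `b` can absorb every path from `u` to `w`. -/
def PathAbsorbs (G : V → V → Prop) (a b : V) (B : List V) (u w : V) : Prop :=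
  ∀ Q, DiPath G u w Q → ∃ B', DiPath G a b B' ∧ B'.Perm (B ++ Q)

variable {G : V → V → Prop}

lemma PathAbsorbs.append_right {a b c d u w : V} {B l B' : List V} (h : PathAbsorbs G a b B u w)
    (e : Link G b l c) (h' : DiPath G c d B') : PathAbsorbs G a d (B ++ (l ++ B')) u w := by
  intro Q hQ
  obtain ⟨A, hA, hp⟩ := h Q hQ
  refine ⟨A ++ (l ++ B'), hA.link e h', ?_⟩
  rw [List.perm_iff_count] at hp ⊢
  intro x
  have := hp x
  simp only [List.count_append] at this ⊢
  omega

lemma PathAbsorbs.append_left {a b c d u w : V} {B l B' : List V} (h' : DiPath G a b B)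
    (e : Link G b l c) (h : PathAbsorbs G c d B' u w) : PathAbsorbs G a d (B ++ (l ++ B')) u w := by
  intro Q hQ
  obtain ⟨A, hA, hp⟩ := h Q hQ
  refine ⟨B ++ (l ++ A), h'.link e hA, ?_⟩
  rw [List.perm_iff_count] at hp ⊢
  intro x
  have := hp x
  simp only [List.count_append] at this ⊢
  omega

variable [Fintype V] {η ν τ : ℝ}

/-- Splitting and rejoining: an alternating walk `xs` of odd length yields a path `B` from `x`
to `σ s` whose vertex set also splits into a path from `x` to `s` and one from `σ x` to `σ s`. -/
lemma RobustDigraph.exists_gadget (h : RobustDigraph G η ν τ) {m : ℕ} (hm : 1 ≤ m * ν)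
    (σ : Equiv.Perm V) {s : V} (k : ℕ) :
    ∀ {x : V} {xs : List V} {Z : Finset V}, xs.length = 2 * k + 1 →
      DiPath (fun x y => G x (σ y)) x s xs → (xs ++ xs.map σ).Nodup →
      (∀ v ∈ xs, G v (σ v)) → (∀ v ∈ xs, v ∈ Z ∧ σ v ∈ Z) →
      (Z.card : ℝ) + (2 * k + 1) * (m + 2) + m < ν * Fintype.card V →
      ∃ E O B : List V, DiPath G x s E ∧ DiPath G (σ x) (σ s) O ∧ DiPath G x (σ s) B ∧
        B.Perm (E ++ O) ∧ B.Nodup ∧ (∀ v ∈ B, v ∈ Z → v ∈ xs ∨ v ∈ xs.map σ) ∧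
        B.length ≤ (2 * k + 1) * (m + 2) := by
  induction k with
  | zero =>
    intro x xs Z hlen hpath hnd hG hZ _
    obtain ⟨y, rfl⟩ := List.length_eq_one_iff.1 hlen
    obtain ⟨-, hx, hs⟩ := hpath
    obtain rfl : y = x := by simpa using hx
    obtain rfl : y = s := by simpa using hs
    refine ⟨[y], [σ y], [y, σ y], DiPath.singleton _, DiPath.singleton _,
      (DiPath.singleton _).cons (hG y (by simp)), by simp, by simpa using hnd,
      by simp, by simp⟩
  | succ k ih =>
    intro x1 xs Z hlen hpath hnd hG hZ hcard
    obtain ⟨y1, x2, x3, ys, rfl⟩ : ∃ y1 x2 x3 ys, xs = y1 :: x2 :: x3 :: ys := by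
      rcases xs with _ | ⟨a, _ | ⟨b, _ | ⟨c, ys⟩⟩⟩
      · simp at hlen
      · simp at hlen
      · simp at hlen
      · exact ⟨a, b, c, ys, rfl⟩
    obtain ⟨hch, hx, hs⟩ := hpath
    obtain rfl : y1 = x1 := by simpa using hx
    simp only [List.isChain_cons_cons] at hch
    obtain ⟨h12, h23, hch⟩ := hch
    have hsub : (x3 :: ys ++ (x3 :: ys).map σ).Nodup := by
      refine hnd.sublist ?_
      refine List.Sublist.append ?_ ?_
      · exact List.sublist_append_right [y1, x2] (x3 :: ys)
      · exact List.sublist_append_right [σ y1, σ x2] ((x3 :: ys).map σ)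
    push_cast at hcard
    have hm0 : (0 : ℝ) ≤ m := Nat.cast_nonneg m
    obtain ⟨E, O, B, hE, hO, hB, hperm, hBnd, hBZ, hBlen⟩ := ih (x := x3) (xs := x3 :: ys)
      (Z := Z) (by simp at hlen ⊢; omega) ⟨hch, by simp, by simpa using hs⟩ hsub
      (fun v hv => hG v (by simp at hv ⊢; tauto)) (fun v hv => hZ v (by simp at hv ⊢; tauto))
      (by linarith)
    have hBlen' : (B.length : ℝ) ≤ (2 * k + 1) * (m + 2) := by exact_mod_cast hBlen
    have hc1 : ((Z ∪ B.toFinset).card : ℝ) ≤ Z.card + B.length := by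
      exact_mod_cast (Finset.card_union_le _ _).trans
        (Nat.add_le_add_left (List.toFinset_card_le B) _)
    obtain ⟨l2, hl2, hlk2, hav2, hnd2⟩ := h.exists_nodup_link hm (σ x2) x3
      (X := Z ∪ B.toFinset) (by linarith)
    have hc2 : ((Z ∪ B.toFinset ∪ l2.toFinset).card : ℝ) ≤ Z.card + B.length + m := by
      have h1 : ((Z ∪ B.toFinset ∪ l2.toFinset).card : ℝ) ≤
          (Z ∪ B.toFinset).card + l2.length := by
        exact_mod_cast (Finset.card_union_le _ _).trans
          (Nat.add_le_add_left (List.toFinset_card_le l2) _)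
      rw [hl2] at h1
      linarith
    obtain ⟨l1, hl1, hlk1, hav1, hnd1⟩ := h.exists_nodup_link hm (σ y1) x2
      (X := Z ∪ B.toFinset ∪ l2.toFinset) (by linarith)
    have hG1 := hG y1 (by simp)
    have hG2 := hG x2 (by simp)
    have hZ1 := hZ y1 (by simp)
    have hZ2 := hZ x2 (by simp)
    refine ⟨y1 :: σ x2 :: (l2 ++ E), σ y1 :: (l1 ++ x2 :: O),
      y1 :: σ y1 :: (l1 ++ x2 :: σ x2 :: (l2 ++ B)), ?_, ?_, ?_, ?_, ?_, ?_, ?_⟩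
    · exact (hE.cons_link hlk2).cons h12
    · exact (hO.cons h23).cons_link hlk1
    · exact (((hB.cons_link hlk2).cons hG2).cons_link hlk1).cons hG1
    · rw [List.perm_iff_count] at hperm ⊢
      intro a
      have := hperm a
      simp only [List.count_append, List.count_cons] at this ⊢
      omega
    · simp only [Finset.mem_union, List.mem_toFinset, not_or] at hav1 hav2
      have hp1 : (y1 :: x2 :: x3 :: ys ++ (y1 :: x2 :: x3 :: ys).map σ).Perm
          ([y1, σ y1, x2, σ x2] ++ (x3 :: ys ++ (x3 :: ys).map σ)) := by
        rw [List.perm_iff_count]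
        intro a
        simp only [List.count_append, List.count_cons, List.map_cons, List.count_nil]
        omega
      have hp2 : (y1 :: σ y1 :: (l1 ++ x2 :: σ x2 :: (l2 ++ B))).Perm
          ([y1, σ y1, x2, σ x2] ++ B ++ l2 ++ l1) := by
        rw [List.perm_iff_count]
        intro a
        simp only [List.count_append, List.count_cons, List.count_nil]
        omega
      have hF : ∀ v ∈ [y1, σ y1, x2, σ x2], v ∈ Z := by
        simp [hZ1, hZ2]
      rw [hp1.nodup_iff, List.nodup_append] at hnd
      rw [hp2.nodup_iff]
      refine List.nodup_append.2 ⟨List.nodup_append.2 ⟨List.nodup_append.2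
        ⟨hnd.1, hBnd, ?_⟩, hnd2, ?_⟩, hnd1, ?_⟩
      · rintro a ha b hb rfl
        exact hnd.2.2 a ha a (List.mem_append.2 (hBZ a hb (hF a ha))) rfl
      · rintro a ha b hb rfl
        rcases List.mem_append.1 ha with ha | ha
        · exact (hav2 a hb).1 (hF a ha)
        · exact (hav2 a hb).2 ha
      · rintro a ha b hb rfl
        rcases List.mem_append.1 ha with ha | ha
        · rcases List.mem_append.1 ha with ha | ha
          · exact (hav1 a hb).1.1 (hF a ha)
          · exact (hav1 a hb).1.2 ha
        · exact (hav1 a hb).2 ha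
    · intro v hv hvZ
      simp only [Finset.mem_union, List.mem_toFinset, not_or] at hav1 hav2
      simp only [List.mem_cons, List.mem_append] at hv
      rcases hv with rfl | rfl | hv | rfl | rfl | hv | hv
      · simp
      · simp
      · exact absurd hvZ (hav1 v hv).1.1
      · simp
      · simp
      · exact absurd hvZ (hav2 v hv).1
      · have := hBZ v hv hvZ
        simp only [List.map_cons, List.mem_cons] at this ⊢
        tauto
    · simp only [List.length_cons, List.length_append, hl1, hl2]
      nlinarith

end Absorb

section Block

variable {V : Type*}

lemma nodup_append_map {σ : Equiv.Perm V} {xs : List V}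
    (hp : xs.Pairwise fun x y => ¬ (x = y ∨ x = σ y ∨ σ x = y)) (hσ : ∀ v ∈ xs, σ v ≠ v) :
    (xs ++ xs.map σ).Nodup := by
  have hnd : xs.Nodup := hp.imp fun h e => h (Or.inl e)
  refine List.nodup_append.2 ⟨hnd, hnd.map σ.injective, ?_⟩
  rintro a ha b hb rfl
  obtain ⟨c, hc, hca⟩ := List.mem_map.1 hb
  have hne : a ≠ c := by
    rintro rfl
    exact hσ a ha hca
  have hsymm : ∀ ⦃x y⦄, ¬ (x = y ∨ x = σ y ∨ σ x = y) → ¬ (y = x ∨ y = σ x ∨ σ y = x) := by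
    intro x y h
    simp only [eq_comm] at h ⊢
    tauto
  have : Std.Symm fun x y => ¬ (x = y ∨ x = σ y ∨ σ x = y) := ⟨fun _ _ h => hsymm h⟩
  exact hp.forall ha hc hne (Or.inr (Or.inl hca.symm))

lemma exists_mul_card_le_card_filter {α β : Type*} {T : α → β → Prop} {A : Finset α}
    {U : Finset β} {c N : ℝ} (hc : 0 < c) (hN : 0 < N) (hA : (A.card : ℝ) ≤ N)
    (hU : U.Nonempty) (hT : ∀ e ∈ U, c * N ≤ ((A.filter fun x => T x e).card : ℝ)) :
    ∃ x ∈ A, c * U.card ≤ ((U.filter fun e => T x e).card : ℝ) := by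
  have hAne : A.Nonempty := by
    obtain ⟨e, he⟩ := hU
    have h1 : (0 : ℝ) < ((A.filter fun x => T x e).card : ℝ) :=
      lt_of_lt_of_le (mul_pos hc hN) (hT e he)
    obtain ⟨x, hx⟩ := Finset.card_pos.1 (Nat.cast_pos.1 h1)
    exact ⟨x, (Finset.mem_filter.1 hx).1⟩
  refine Finset.exists_le_of_sum_le hAne ?_
  have h1 : ∑ x ∈ A, ((U.filter fun e => T x e).card : ℝ) =
      ∑ e ∈ U, ((A.filter fun x => T x e).card : ℝ) := by
    exact_mod_cast Finset.sum_card_bipartiteAbove_eq_sum_card_bipartiteBelow T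
  rw [h1]
  refine le_trans ?_ (Finset.sum_le_sum hT)
  simp only [Finset.sum_const, nsmul_eq_mul]
  have : (0 : ℝ) ≤ c * U.card := by positivity
  nlinarith

lemma card_union_image_symm_le (σ : Equiv.Perm V) (X : Finset V) :
    (X ∪ X.image σ.symm).card ≤ 2 * X.card := by
  refine (Finset.card_union_le _ _).trans ?_
  have := Finset.card_image_le (s := X) (f := σ.symm)
  omega

variable [Fintype V]

lemma card_conflict_le (σ : Equiv.Perm V) (x : V) :
    (univ.filter fun y => x = y ∨ x = σ y ∨ σ x = y).card ≤ 3 := by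
  refine (Finset.card_le_card (t := {x, σ.symm x, σ x}) ?_).trans Finset.card_le_three
  intro y hy
  simp only [Finset.mem_filter, Finset.mem_univ, true_and, Finset.mem_insert,
    Finset.mem_singleton] at hy ⊢
  rcases hy with rfl | rfl | rfl <;> simp

variable {G : V → V → Prop} {η ν τ : ℝ}

lemma RobustDigraph.exists_block (h : RobustDigraph G η ν τ) {m : ℕ} (hm : 1 ≤ m * ν)
    (hodd : Odd m) (hloop : ∀ v, ¬ G v v) {σ : Equiv.Perm V} {X : Finset V}
    (hG : ∀ v ∉ X, G v (σ v)) {x s : V} (hx : x ∉ X ∪ X.image σ.symm)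
    (hs : s ∉ X ∪ X.image σ.symm) (hxs : ¬ (x = s ∨ x = σ s ∨ σ x = s))
    (hcard : 2 * (X.card : ℝ) + (m + 4) ^ 2 < ν * Fintype.card V) :
    ∃ B : List V, DiPath G x (σ s) B ∧ B.Nodup ∧ (∀ v ∈ B, v ∉ X) ∧
      B.length ≤ (m + 2) ^ 2 ∧ ∀ u w, G w (σ x) → G s u → PathAbsorbs G x (σ s) B u w := by
  have hm0 : (0 : ℝ) ≤ m := Nat.cast_nonneg m
  set N : V → Finset V := fun x => univ.filter fun y => x = y ∨ x = σ y ∨ σ x = y with hN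
  have hN3 : ∀ x, (N x).card ≤ 3 := card_conflict_le σ
  have hX1 : (((X ∪ X.image σ.symm) ∪ (N x ∪ N s)).card : ℝ) ≤ 2 * X.card + 6 := by
    have h1 := card_union_image_symm_le σ X
    have h2 := Finset.card_union_le (X ∪ X.image σ.symm) (N x ∪ N s)
    have h3 := Finset.card_union_le (N x) (N s)
    have h4 := hN3 x
    have h5 := hN3 s
    exact_mod_cast (by omega :
      ((X ∪ X.image σ.symm) ∪ (N x ∪ N s)).card ≤ 2 * X.card + 6)
  obtain ⟨l, hl, hlk, hav, hp⟩ := (h.comp_perm σ).exists_link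
    (C := fun x y => x = y ∨ x = σ y ∨ σ x = y) (q := 3) (fun v => by convert hN3 v) hm x s
    (X := (X ∪ X.image σ.symm) ∪ (N x ∪ N s)) (by push_cast; nlinarith)
  set xs := x :: (l ++ [s]) with hxsdef
  have hxsX : ∀ v ∈ xs, v ∉ X ∪ X.image σ.symm := by
    intro v hv
    simp only [hxsdef, List.mem_cons, List.mem_append, List.not_mem_nil, or_false] at hv
    rcases hv with rfl | hv | rfl
    · exact hx
    · exact fun hc => hav v hv (Finset.mem_union_left _ hc)
    · exact hs
  have hxsX1 : ∀ v ∈ xs, v ∉ X := fun v hv hc => hxsX v hv (Finset.mem_union_left _ hc)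
  have hxsX2 : ∀ v ∈ xs, σ v ∉ X := fun v hv hc =>
    hxsX v hv (Finset.mem_union_right _ (Finset.mem_image.2 ⟨σ v, hc, by simp⟩))
  have hGxs : ∀ v ∈ xs, G v (σ v) := fun v hv => hG v (hxsX1 v hv)
  have hlN : ∀ v ∈ l, v ∉ N x ∧ v ∉ N s := fun v hv =>
    ⟨fun hc => hav v hv (by simp only [Finset.mem_union]; tauto),
      fun hc => hav v hv (by simp only [Finset.mem_union]; tauto)⟩
  simp only [hN, Finset.mem_filter, Finset.mem_univ, true_and] at hlN
  have hnd : (xs ++ xs.map σ).Nodup := by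
    refine nodup_append_map ?_ fun v hv e => hloop v (by simpa [e] using hGxs v hv)
    rw [hxsdef, List.pairwise_cons, List.pairwise_append]
    refine ⟨?_, hp.imp ?_, by simp, ?_⟩
    · intro v hv
      simp only [List.mem_append, List.mem_singleton] at hv
      rcases hv with hv | rfl
      · exact (hlN v hv).1
      · exact hxs
    · intro a b hab
      simp only [eq_comm] at hab ⊢
      tauto
    · intro a ha b hb
      rw [List.mem_singleton.1 hb]
      have := (hlN a ha).2
      simp only [eq_comm] at this ⊢
      tauto
  obtain ⟨j, rfl⟩ := hodd
  have hxlen : xs.length = 2 * (j + 1) + 1 := by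
    simp [hxsdef, hl]
    ring
  set Z := X ∪ (xs.toFinset ∪ (xs.map σ).toFinset) with hZ
  have hZc : (Z.card : ℝ) ≤ X.card + 2 * (2 * (j + 1) + 1) := by
    have h1 := Finset.card_union_le X (xs.toFinset ∪ (xs.map σ).toFinset)
    have h2 := Finset.card_union_le xs.toFinset (xs.map σ).toFinset
    have h3 := List.toFinset_card_le xs
    have h4 := List.toFinset_card_le (xs.map σ)
    rw [List.length_map] at h4
    rw [← hZ] at h1
    exact_mod_cast (by omega : Z.card ≤ X.card + 2 * (2 * (j + 1) + 1))
  have hX0 : (0 : ℝ) ≤ X.card := Nat.cast_nonneg _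
  obtain ⟨E, O, B, hE, hO, hB, hperm, hBnd, hBZ, hBlen⟩ := h.exists_gadget hm σ (j + 1)
    hxlen hlk.diPath hnd hGxs (Z := Z) (by
      intro v hv
      simp only [hZ, Finset.mem_union, List.mem_toFinset]
      exact ⟨Or.inr (Or.inl hv), Or.inr (Or.inr (List.mem_map_of_mem hv))⟩) (by
      push_cast at hcard ⊢
      nlinarith)
  refine ⟨B, hB, hBnd, ?_, hBlen.trans (le_of_eq (by ring)), ?_⟩
  · intro v hv hvX
    rcases hBZ v hv (Finset.mem_union_left _ hvX) with h1 | h1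
    · exact hxsX1 v h1 hvX
    · obtain ⟨c, hc, rfl⟩ := List.mem_map.1 h1
      exact hxsX2 c hc hvX
  · intro u w hw hu Q hQ
    refine ⟨E ++ (Q ++ O), hE.append hu (hQ.append hw hO), ?_⟩
    rw [List.perm_iff_count] at hperm ⊢
    intro a
    have := hperm a
    simp only [List.count_append] at this ⊢
    omega

lemma card_filter_le_card_compl_filter_add (P : V → Prop) (Y : Finset V) :
    ((univ.filter P).card : ℝ) ≤ (Yᶜ.filter P).card + Y.card := by
  refine mod_cast (Finset.card_le_card ?_).trans (Finset.card_union_le _ _)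
  intro v hv
  by_cases hvY : v ∈ Y <;> simp_all

lemma RobustDigraph.exists_absorbing_block (h : RobustDigraph G η ν τ) {m : ℕ}
    (hm : 1 ≤ m * ν) (hodd : Odd m) (hloop : ∀ v, ¬ G v v) {σ : Equiv.Perm V} {X : Finset V}
    (hG : ∀ v ∉ X, G v (σ v))
    (hcard : 2 * (X.card : ℝ) + (m + 4) ^ 2 < ν * Fintype.card V)
    {U : Finset (V × V)} (hU : U.Nonempty) :
    ∃ (x y : V) (B : List V), DiPath G x y B ∧ B.Nodup ∧ (∀ v ∈ B, v ∉ X) ∧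
      B.length ≤ (m + 2) ^ 2 ∧
      (η / 2) ^ 2 * U.card ≤ ((U.filter fun e => PathAbsorbs G x y B e.1 e.2).card : ℝ) := by
  have hν := h.nu_pos
  have hντ := h.nu_le
  have hη := h.add_le
  have hm0 : (0 : ℝ) ≤ m := Nat.cast_nonneg m
  have hn : (0 : ℝ) < Fintype.card V := by
    obtain ⟨e, -⟩ := hU
    exact_mod_cast Fintype.card_pos_iff.2 ⟨e.1⟩
  have hY := card_union_image_symm_le σ X
  set Y := X ∪ X.image σ.symm
  have hYc : (Y.card : ℝ) + 3 ≤ η / 2 * Fintype.card V := by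
    have h1 : (Y.card : ℝ) ≤ 2 * X.card := by exact_mod_cast hY
    have h2 := mul_le_mul_of_nonneg_right (show ν ≤ η / 2 by linarith) hn.le
    nlinarith
  have hle : ∀ A : Finset V, (A.card : ℝ) ≤ Fintype.card V := fun A => by
    exact_mod_cast Finset.card_le_univ A
  obtain ⟨x, hxA, hx⟩ := exists_mul_card_le_card_filter
    (T := fun x (e : V × V) => G e.2 (σ x)) (A := Yᶜ)
    (c := η / 2) (by linarith) hn (hle _) hU (by
      intro e _
      have h1 := card_filter_le_card_compl_filter_add (fun x => G e.2 (σ x)) Y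
      have h2 := (h.comp_perm σ).le_outDeg e.2
      rw [outDeg] at h2
      linarith)
  set U' := U.filter fun e => G e.2 (σ x)
  have hU' : U'.Nonempty := by
    have h1 : (0 : ℝ) < U.card := by exact_mod_cast Finset.card_pos.2 hU
    refine Finset.card_pos.1 (Nat.cast_pos.1 (lt_of_lt_of_le (mul_pos ?_ h1) hx))
    linarith
  have hN := card_conflict_le σ x
  set N := univ.filter fun y => x = y ∨ x = σ y ∨ σ x = y with hNdef
  obtain ⟨s, hsA, hs⟩ := exists_mul_card_le_card_filter
    (T := fun s (e : V × V) => G s e.1) (A := (Y ∪ N)ᶜ)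
    (c := η / 2) (by linarith) hn (hle _) hU' (by
      intro e _
      have h1 := card_filter_le_card_compl_filter_add (fun s => G s e.1) (Y ∪ N)
      have h2 := h.le_inDeg e.1
      rw [inDeg] at h2
      have h3 : ((Y ∪ N).card : ℝ) ≤ Y.card + 3 := by
        exact_mod_cast (Finset.card_union_le Y N).trans (Nat.add_le_add_left hN _)
      linarith)
  rw [Finset.mem_compl] at hxA hsA
  obtain ⟨B, hB, hBnd, hBX, hBlen, habs⟩ := h.exists_block hm hodd hloop hG (x := x) (s := s) hxA
    (fun hc => hsA (Finset.mem_union_left _ hc))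
    (fun hc => hsA (Finset.mem_union_right _ (by simpa [hNdef] using hc))) hcard
  refine ⟨x, σ s, B, hB, hBnd, hBX, hBlen, ?_⟩
  calc (η / 2) ^ 2 * U.card = η / 2 * (η / 2 * U.card) := by ring
    _ ≤ η / 2 * U'.card := by
      refine mul_le_mul_of_nonneg_left hx ?_
      linarith
    _ ≤ _ := hs
    _ ≤ _ := by
      refine Nat.cast_le.2 (Finset.card_le_card ?_)
      intro e he
      simp only [U', Finset.mem_filter] at he ⊢
      exact ⟨he.1.1, habs e.1 e.2 he.1.2 he.2⟩

end Block

section UniversalAbsorber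

variable {V : Type*}

lemma card_union_toFinset_le (X : Finset V) (l : List V) :
    ((X ∪ l.toFinset).card : ℝ) ≤ X.card + l.length := by
  exact_mod_cast (Finset.card_union_le _ _).trans
    (Nat.add_le_add_left (List.toFinset_card_le l) _)

variable [Fintype V] {G : V → V → Prop} {η ν τ : ℝ}

lemma RobustDigraph.exists_notMem (h : RobustDigraph G η ν τ) {X : Finset V}
    (hX : (X.card : ℝ) < ν * Fintype.card V) : ∃ v, v ∉ X := by
  by_contra! hc
  have hν := h.nu_pos
  have hντ := h.nu_le
  have hη := h.add_le
  obtain rfl : X = univ := Finset.eq_univ_of_forall hc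
  rw [Finset.card_univ] at hX
  have hn : (0 : ℝ) < Fintype.card V := by
    by_contra! h0
    nlinarith
  obtain ⟨v⟩ : Nonempty V := Fintype.card_pos_iff.1 (by exact_mod_cast hn)
  have h1 := h.le_outDeg v
  have h2 : (outDeg G v : ℝ) ≤ Fintype.card V := by exact_mod_cast Finset.card_le_univ _
  nlinarith

lemma RobustDigraph.exists_partial_absorber (h : RobustDigraph G η ν τ) {m : ℕ}
    (hm : 1 ≤ m * ν) (hodd : Odd m) (hloop : ∀ v, ¬ G v v) {σ : Equiv.Perm V} {X : Finset V}
    (hG : ∀ v ∉ X, G v (σ v)) (i : ℕ) :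
    2 * (X.card : ℝ) + 2 * i * (m + 4) ^ 2 < ν * Fintype.card V →
    ∃ (a b : V) (A : List V), DiPath G a b A ∧ A.Nodup ∧ (∀ v ∈ A, v ∉ X) ∧
      A.length ≤ i * (m + 4) ^ 2 + 1 ∧
      ((univ.filter fun e : V × V => ¬ PathAbsorbs G a b A e.1 e.2).card : ℝ) ≤
        (1 - (η / 2) ^ 2) ^ i * (Fintype.card V : ℝ) ^ 2 := by
  have hν := h.nu_pos
  have hντ := h.nu_le
  have hη := h.add_le
  have hX0 : (0 : ℝ) ≤ X.card := Nat.cast_nonneg _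
  have hm0 : (0 : ℝ) ≤ m := Nat.cast_nonneg _
  induction i with
  | zero =>
    intro hcard
    push_cast at hcard
    obtain ⟨v, hv⟩ := h.exists_notMem (X := X) (by linarith)
    refine ⟨v, v, [v], DiPath.singleton v, by simp, by simpa using hv, by simp, ?_⟩
    have h1 := Finset.card_le_univ (univ.filter fun e : V × V => ¬ PathAbsorbs G v v [v] e.1 e.2)
    rw [Fintype.card_prod] at h1
    rw [pow_zero, one_mul, sq]
    exact_mod_cast h1
  | succ i ih =>
    intro hcard
    push_cast at hcard
    have hi0 : (0 : ℝ) ≤ i := Nat.cast_nonneg _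
    have hη1 : 0 ≤ 1 - (η / 2) ^ 2 := by
      obtain ⟨v, hv⟩ := h.exists_notMem (X := X) (by nlinarith)
      have hn : (0 : ℝ) < Fintype.card V := by
        exact_mod_cast Fintype.card_pos_iff.2 ⟨v⟩
      have h1 := h.le_outDeg v
      have h2 : (outDeg G v : ℝ) ≤ Fintype.card V := by exact_mod_cast Finset.card_le_univ _
      have h3 : η ≤ 1 := by
        by_contra! hc
        nlinarith
      nlinarith
    obtain ⟨a, b, A, hA, hAnd, hAX, hAlen, hAcov⟩ := ih (by nlinarith)
    set U := univ.filter fun e : V × V => ¬ PathAbsorbs G a b A e.1 e.2 with hUdef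
    rcases U.eq_empty_or_nonempty with hU | hU
    · refine ⟨a, b, A, hA, hAnd, hAX, hAlen.trans ?_, ?_⟩
      · gcongr
        omega
      · rw [← hUdef, hU]
        simp only [Finset.card_empty, Nat.cast_zero]
        positivity
    have hAlen' : (A.length : ℝ) ≤ i * (m + 4) ^ 2 + 1 := by exact_mod_cast hAlen
    have hXA := card_union_toFinset_le X A
    obtain ⟨x, y, B, hB, hBnd, hBX, hBlen, hBcov⟩ := h.exists_absorbing_block hm hodd hloop
      (σ := σ) (X := X ∪ A.toFinset)
      (fun v hv => hG v fun hc => hv (Finset.mem_union_left _ hc)) (by nlinarith) hU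
    have hBlen' : (B.length : ℝ) ≤ (m + 2) ^ 2 := by exact_mod_cast hBlen
    have hXAB := card_union_toFinset_le (X ∪ A.toFinset) B
    obtain ⟨l, hl, hlk, hlX, hlnd⟩ := h.exists_nodup_link hm b x
      (X := X ∪ A.toFinset ∪ B.toFinset) (by nlinarith)
    simp only [Finset.mem_union, List.mem_toFinset, not_or] at hlX hBX
    refine ⟨a, y, A ++ (l ++ B), hA.link hlk hB, ?_, ?_, ?_, ?_⟩
    · refine List.nodup_append.2 ⟨hAnd, List.nodup_append.2 ⟨hlnd, hBnd, ?_⟩, ?_⟩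
      · rintro c hc d hd rfl
        exact (hlX c hc).2 hd
      · rintro c hc d hd rfl
        rcases List.mem_append.1 hd with hd | hd
        · exact (hlX c hd).1.2 hc
        · exact (hBX c hd).2 hc
    · intro v hv
      simp only [List.mem_append] at hv
      rcases hv with hv | hv | hv
      · exact hAX v hv
      · exact (hlX v hv).1.1
      · exact (hBX v hv).1
    · simp only [List.length_append, hl]
      nlinarith
    · have h1 : (univ.filter fun e : V × V => ¬ PathAbsorbs G a y (A ++ (l ++ B)) e.1 e.2).card +
          (U.filter fun e => PathAbsorbs G x y B e.1 e.2).card ≤ U.card := by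
        rw [← Finset.card_union_of_disjoint]
        · refine Finset.card_le_card (Finset.union_subset ?_ (Finset.filter_subset _ _))
          intro e he
          simp only [hUdef, Finset.mem_filter, Finset.mem_univ, true_and] at he ⊢
          exact fun hc => he (hc.append_right hlk hB)
        · rw [Finset.disjoint_left]
          intro e he he'
          simp only [Finset.mem_filter, Finset.mem_univ, true_and] at he he'
          exact he (he'.2.append_left hA hlk)
      have h2 : ((univ.filter fun e : V × V =>
          ¬ PathAbsorbs G a y (A ++ (l ++ B)) e.1 e.2).card : ℝ) +
          (U.filter fun e => PathAbsorbs G x y B e.1 e.2).card ≤ U.card := by exact_mod_cast h1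
      calc _ ≤ (1 - (η / 2) ^ 2) * U.card := by linarith
        _ ≤ (1 - (η / 2) ^ 2) * ((1 - (η / 2) ^ 2) ^ i * (Fintype.card V : ℝ) ^ 2) :=
          mul_le_mul_of_nonneg_left hAcov hη1
        _ = _ := by ring

lemma RobustDigraph.exists_universal_absorber (h : RobustDigraph G η ν τ) {m : ℕ}
    (hm : 1 ≤ m * ν) (hodd : Odd m) (hloop : ∀ v, ¬ G v v) {σ : Equiv.Perm V} {X : Finset V}
    (hG : ∀ v ∉ X, G v (σ v)) {R : ℕ}
    (hR : (1 - (η / 2) ^ 2) ^ R * (Fintype.card V : ℝ) ^ 2 < 1)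
    (hcard : 2 * (X.card : ℝ) + 2 * R * (m + 4) ^ 2 < ν * Fintype.card V) :
    ∃ (a b : V) (A : List V), DiPath G a b A ∧ A.Nodup ∧ (∀ v ∈ A, v ∉ X) ∧
      A.length ≤ R * (m + 4) ^ 2 + 1 ∧ ∀ u w, PathAbsorbs G a b A u w := by
  obtain ⟨a, b, A, hA, hAnd, hAX, hAlen, hAcov⟩ :=
    h.exists_partial_absorber hm hodd hloop hG R hcard
  refine ⟨a, b, A, hA, hAnd, hAX, hAlen, fun u w => ?_⟩
  by_contra hc
  have h1 := hAcov.trans_lt hR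
  rw [Nat.cast_lt_one, Finset.card_eq_zero, Finset.filter_eq_empty_iff] at h1
  exact h1 (Finset.mem_univ (u, w)) hc

/-- A path that can absorb any `r` paths simultaneously. -/
lemma RobustDigraph.exists_absorber (h : RobustDigraph G η ν τ) {m : ℕ}
    (hm : 1 ≤ m * ν) (hodd : Odd m) (hloop : ∀ v, ¬ G v v) {σ : Equiv.Perm V} {X : Finset V}
    (hG : ∀ v ∉ X, G v (σ v)) {R : ℕ}
    (hR : (1 - (η / 2) ^ 2) ^ R * (Fintype.card V : ℝ) ^ 2 < 1) (r : ℕ) :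
    2 * (X.card : ℝ) + 2 * (r * ((R + 1) * (m + 4) ^ 2) + 1) < ν * Fintype.card V →
    ∃ (a b : V) (A : List V), DiPath G a b A ∧ A.Nodup ∧ (∀ v ∈ A, v ∉ X) ∧
      A.length ≤ r * ((R + 1) * (m + 4) ^ 2) + 1 ∧
      ∀ Qs : List (List V), Qs.length ≤ r → (∀ Q ∈ Qs, ∃ u w, DiPath G u w Q) →
        ∃ A', DiPath G a b A' ∧ A'.Perm (A ++ Qs.flatten) := by
  have hX0 : (0 : ℝ) ≤ X.card := Nat.cast_nonneg _
  have hm0 : (0 : ℝ) ≤ m := Nat.cast_nonneg _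
  have hR0 : (0 : ℝ) ≤ R := Nat.cast_nonneg _
  induction r with
  | zero =>
    intro hcard
    push_cast at hcard
    obtain ⟨v, hv⟩ := h.exists_notMem (X := X) (by linarith)
    refine ⟨v, v, [v], DiPath.singleton v, by simp, by simpa using hv, by simp, ?_⟩
    intro Qs hQs _
    obtain rfl : Qs = [] := List.length_eq_zero_iff.1 (Nat.le_zero.1 hQs)
    exact ⟨[v], DiPath.singleton v, by simp⟩
  | succ r ih =>
    intro hcard
    push_cast at hcard
    have hr0 : (0 : ℝ) ≤ r * ((R + 1) * (m + 4) ^ 2) := by positivity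
    have hRm0 : (0 : ℝ) ≤ R * (m + 4) ^ 2 := by positivity
    obtain ⟨a, b, A, hA, hAnd, hAX, hAlen, habs⟩ := ih (by nlinarith)
    have hAlen' : (A.length : ℝ) ≤ r * ((R + 1) * (m + 4) ^ 2) + 1 := by exact_mod_cast hAlen
    have hXA := card_union_toFinset_le X A
    obtain ⟨x, y, B, hB, hBnd, hBX, hBlen, huniv⟩ := h.exists_universal_absorber hm hodd hloop
      (σ := σ) (X := X ∪ A.toFinset)
      (fun v hv => hG v fun hc => hv (Finset.mem_union_left _ hc)) hR (by nlinarith)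
    have hBlen' : (B.length : ℝ) ≤ R * (m + 4) ^ 2 + 1 := by exact_mod_cast hBlen
    have hXAB := card_union_toFinset_le (X ∪ A.toFinset) B
    obtain ⟨l, hl, hlk, hlX, hlnd⟩ := h.exists_nodup_link hm b x
      (X := X ∪ A.toFinset ∪ B.toFinset) (by nlinarith)
    simp only [Finset.mem_union, List.mem_toFinset, not_or] at hlX hBX
    refine ⟨a, y, A ++ (l ++ B), hA.link hlk hB, ?_, ?_, ?_, ?_⟩
    · refine List.nodup_append.2 ⟨hAnd, List.nodup_append.2 ⟨hlnd, hBnd, ?_⟩, ?_⟩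
      · rintro c hc d hd rfl
        exact (hlX c hc).2 hd
      · rintro c hc d hd rfl
        rcases List.mem_append.1 hd with hd | hd
        · exact (hlX c hd).1.2 hc
        · exact (hBX c hd).2 hc
    · intro v hv
      simp only [List.mem_append] at hv
      rcases hv with hv | hv | hv
      · exact hAX v hv
      · exact (hlX v hv).1.1
      · exact (hBX v hv).1
    · simp only [List.length_append, hl]
      nlinarith
    · intro Qs hQs hpaths
      rcases Qs with _ | ⟨Q, Qs⟩
      · exact ⟨A ++ (l ++ B), hA.link hlk hB, by simp⟩
      · obtain ⟨u, w, hQ⟩ := hpaths Q (by simp)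
        obtain ⟨B', hB', hpB⟩ := huniv u w Q hQ
        obtain ⟨A', hA', hpA⟩ := habs Qs (by simpa using hQs)
          fun Q' hQ' => hpaths Q' (by simp [hQ'])
        refine ⟨A' ++ (l ++ B'), hA'.link hlk hB', ?_⟩
        rw [List.perm_iff_count] at hpA hpB ⊢
        intro v
        have h1 := hpA v
        have h2 := hpB v
        simp only [List.flatten_cons, List.count_append] at h1 h2 ⊢
        omega

end UniversalAbsorber

section LongCycles

variable {V : Type*}

lemma iterate_eq_of_notMem {f g : V → V} {S : Finset V} (hfg : ∀ v ∉ S, g v = f v) {w : V}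
    {d : ℕ} (hd : ∀ i < d, g^[i] w ∉ S) : g^[d] w = f^[d] w := by
  induction d with
  | zero => rfl
  | succ d ih =>
    rw [Function.iterate_succ_apply', Function.iterate_succ_apply',
      ← ih fun i hi => hd i (hi.trans d.lt_succ_self), hfg _ (hd d d.lt_succ_self)]

/-- The permutation `σ` fixes `Z`, follows edges of `G` outside `Z` and the exceptional set `D`,
and all its orbits of length less than `K` outside `Z` meet `D`. -/
structure LongCycleFactor (G : V → V → Prop) (Z : Finset V) (K : ℕ) (σ : Equiv.Perm V)
    (D : Finset V) : Prop where
  fixed : ∀ v ∈ Z, σ v = v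
  notMem : ∀ v ∈ D, v ∉ Z
  edge : ∀ v ∉ Z, v ∉ D → G v (σ v)
  short : ∀ v ∉ Z, ∀ j, 0 < j → j < K → σ^[j] v = v → ∃ i, σ^[i] v ∈ D

/-- `x` and `y` are at distance at most `K` along an orbit of `σ`. -/
def OrbitClose (σ : Equiv.Perm V) (K : ℕ) (x y : V) : Prop :=
  ∃ e ≤ K, σ^[e] x = y ∨ σ^[e] y = x

lemma OrbitClose.symm {σ : Equiv.Perm V} {K : ℕ} {x y : V} (h : OrbitClose σ K x y) :
    OrbitClose σ K y x := by
  obtain ⟨e, he, h⟩ := h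
  exact ⟨e, he, h.symm⟩

lemma LongCycleFactor.rotate {G : V → V → Prop} {Z : Finset V} {K : ℕ} {σ : Equiv.Perm V}
    {D : Finset V} (h : LongCycleFactor G Z K σ D) {b b' : V} {l : List V} (hb' : b' ∈ D)
    (hbb' : b ≠ b') (hl : l ≠ []) (hlk : Link (fun x y => G x (σ y)) b l b')
    (hZ : ∀ v ∈ b :: (l ++ [b']), v ∉ Z) (hnd : (b :: (l ++ [b'])).Nodup)
    (hconf : ∀ x ∈ b :: (l ++ [b']), ∀ y ∈ b :: (l ++ [b']), x ≠ y → x ∈ l ∨ y ∈ l →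
      ¬ OrbitClose σ K x y) :
    LongCycleFactor G Z K (σ * (b :: (l ++ [b'])).formPerm) (D.erase b) := by
  set xs := b :: (l ++ [b']) with hxs
  set ρ := xs.formPerm
  have hb'D : b' ∈ D.erase b := Finset.mem_erase.2 ⟨hbb'.symm, hb'⟩
  have hlen : xs.length = l.length + 2 := by simp [hxs]
  have hlast : xs[l.length + 1]'(by omega) = b' := by simp [hxs]
  have hidx : ∀ p ∈ xs, p ≠ b' → ∃ i, ∃ hi : i + 1 < xs.length, xs[i] = p := by
    intro p hp hpb
    obtain ⟨i, hi, rfl⟩ := List.getElem_of_mem hp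
    refine ⟨i, ?_, rfl⟩
    by_contra hc
    obtain rfl : i = l.length + 1 := by omega
    exact hpb hlast
  have hρmem : ∀ p ∈ xs, p ≠ b' → ρ p ∈ xs ∧ ρ p ≠ b ∧ G p (σ (ρ p)) := by
    intro p hp hpb
    obtain ⟨i, hi, rfl⟩ := hidx p hp hpb
    rw [List.formPerm_apply_lt_getElem _ hnd _ hi]
    refine ⟨List.getElem_mem _, ?_, List.isChain_iff_getElem.1 hlk i hi⟩
    intro hc
    have : xs[i + 1] = xs[0] := hc
    rw [hnd.getElem_inj_iff] at this
    omega
  have hρb : ρ b ≠ b' := by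
    have h0 : 0 + 1 < xs.length := by omega
    have h1 : ρ xs[0] = xs[1] := List.formPerm_apply_lt_getElem _ hnd _ h0
    have h2 := List.length_pos_of_ne_nil hl
    intro hc
    rw [show xs[0] = b from rfl] at h1
    rw [h1, ← hlast, hnd.getElem_inj_iff] at hc
    omega
  have hoff : ∀ v ∉ xs.toFinset, (σ * ρ) v = σ v := by
    intro v hv
    rw [Equiv.Perm.mul_apply, List.formPerm_apply_of_notMem (by simpa using hv)]
  have hmemb : b ∈ xs := by simp [hxs]
  have key : ∀ j, 0 < j → j < K → ∀ p ∈ xs, p ≠ b' → (σ * ρ)^[j] p = p →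
      (∀ i, (σ * ρ)^[i] p ∉ D.erase b) → ρ p = b' ∧ ∃ d, (σ * ρ)^[d] p = b := by
    intro j hj0 hjK p hp hpb hper hav
    obtain ⟨hu, hub, -⟩ := hρmem p hp hpb
    have hex : ∃ d, (σ * ρ)^[d + 1] p ∈ xs :=
      ⟨j - 1, by rw [Nat.sub_add_cancel hj0, hper]; exact hp⟩
    obtain ⟨d, hd, hdmin, hdj⟩ : ∃ d, (σ * ρ)^[d + 1] p ∈ xs ∧
        (∀ i < d, (σ * ρ)^[i + 1] p ∉ xs) ∧ d + 1 ≤ j := by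
      refine ⟨Nat.find hex, Nat.find_spec hex, fun i hi => Nat.find_min hex hi, ?_⟩
      have := Nat.find_min' hex (m := j - 1) (by rw [Nat.sub_add_cancel hj0, hper]; exact hp)
      omega
    have hit : ∀ i ≤ d, (σ * ρ)^[i + 1] p = σ^[i + 1] (ρ p) := by
      intro i hi
      rw [Function.iterate_succ_apply, Function.iterate_succ_apply]
      refine iterate_eq_of_notMem hoff fun i' hi' => ?_
      rw [Equiv.Perm.mul_apply, List.mem_toFinset]
      have := hdmin i' (by omega)
      rwa [Function.iterate_succ_apply] at this
    have hyb : (σ * ρ)^[d + 1] p ≠ b' := fun hc => hav (d + 1) (hc ▸ hb'D)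
    have hclose : OrbitClose σ K (ρ p) ((σ * ρ)^[d + 1] p) :=
      ⟨d + 1, by omega, Or.inl (hit d le_rfl).symm⟩
    have hmem_l : ∀ v ∈ xs, v ≠ b → v ≠ b' → v ∈ l := by
      intro v hv h1 h2
      simp only [hxs, List.mem_cons, List.mem_append, List.not_mem_nil, or_false] at hv
      tauto
    by_cases hc : ρ p = b'
    · refine ⟨hc, d + 1, ?_⟩
      by_contra hyb2
      exact hconf _ hu _ hd (fun e => hyb (e ▸ hc)) (Or.inr (hmem_l _ hd hyb2 hyb)) hclose
    · exfalso
      have hul := hmem_l _ hu hub hc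
      by_cases hy : ρ p = (σ * ρ)^[d + 1] p
      · have hper' : σ^[d + 1] (ρ p) = ρ p := by rw [← hit d le_rfl, ← hy]
        obtain ⟨i, hi⟩ := h.short _ (hZ _ hu) (d + 1) (by omega) (by omega) hper'
        rw [← Function.IsPeriodicPt.iterate_mod_apply (n := d + 1) hper' i] at hi
        have hid : i % (d + 1) < d + 1 := Nat.mod_lt i (Nat.succ_pos d)
        rcases Nat.eq_zero_or_pos (i % (d + 1)) with h0 | h0
        · rw [h0, Function.iterate_zero_apply] at hi
          exact hav (d + 1) (hy ▸ Finset.mem_erase.2 ⟨hub, hi⟩)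
        · obtain ⟨i', hi'⟩ : ∃ i', i % (d + 1) = i' + 1 := ⟨_, (Nat.sub_add_cancel h0).symm⟩
          rw [hi', ← hit i' (by omega)] at hi
          refine hav (i' + 1) (Finset.mem_erase.2 ⟨fun hc => ?_, hi⟩)
          exact hdmin i' (by omega) (hc ▸ hmemb)
      · exact hconf _ hu _ hd hy (Or.inl hul) hclose
  refine ⟨?_, ?_, ?_, ?_⟩
  · intro v hv
    rw [hoff v fun hc => hZ v (List.mem_toFinset.1 hc) hv, h.fixed v hv]
  · exact fun v hv => h.notMem v (Finset.mem_of_mem_erase hv)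
  · intro v hvZ hvD
    by_cases hv : v ∈ xs
    · exact (hρmem v hv fun hc => hvD (hc ▸ hb'D)).2.2
    · rw [hoff v (by simpa using hv)]
      exact h.edge v hvZ fun hc => hvD (Finset.mem_erase.2 ⟨fun e => hv (e ▸ hmemb), hc⟩)
  · intro v hvZ j hj0 hjK hper
    by_contra! hav
    have hperi : ∀ i, (σ * ρ)^[j] ((σ * ρ)^[i] v) = (σ * ρ)^[i] v := by
      intro i
      rw [← Function.iterate_add_apply, Nat.add_comm, Function.iterate_add_apply, hper]
    have havi : ∀ i k, (σ * ρ)^[k] ((σ * ρ)^[i] v) ∉ D.erase b := by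
      intro i k
      rw [← Function.iterate_add_apply]
      exact hav _
    have hne : ∀ i, (σ * ρ)^[i] v ≠ b' := fun i hc => hav i (hc ▸ hb'D)
    by_cases hx : ∃ i, (σ * ρ)^[i] v ∈ xs
    · obtain ⟨i, hi⟩ := hx
      obtain ⟨-, d, hd⟩ := key j hj0 hjK _ hi (hne i) (hperi i) (havi i)
      rw [← Function.iterate_add_apply] at hd
      have h1 := key j hj0 hjK b hmemb hbb' (hd ▸ hperi (d + i)) (hd ▸ havi (d + i))
      exact hρb h1.1
    · push Not at hx
      have hit : ∀ i, (σ * ρ)^[i] v = σ^[i] v := fun i =>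
        iterate_eq_of_notMem hoff fun i' _ => by simpa using hx i'
      obtain ⟨i, hi⟩ := h.short v hvZ j hj0 hjK (by rw [← hit, hper])
      rw [← hit] at hi
      exact hav i (Finset.mem_erase.2 ⟨fun hc => hx i (hc ▸ hmemb), hi⟩)

variable [Fintype V]

lemma card_orbitClose_le (σ : Equiv.Perm V) (K : ℕ) (x : V) :
    (univ.filter fun y => OrbitClose σ K x y).card ≤ 2 * (K + 1) := by
  have hsub : (univ.filter fun y => OrbitClose σ K x y) ⊆
      (range (K + 1)).image (fun e => σ^[e] x) ∪ (range (K + 1)).image (fun e => σ.symm^[e] x) := by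
    intro y hy
    obtain ⟨e, he, h⟩ := (Finset.mem_filter.1 hy).2
    rw [Finset.mem_union, Finset.mem_image, Finset.mem_image]
    rcases h with rfl | rfl
    · exact Or.inl ⟨e, by simpa [Nat.lt_succ_iff] using he, rfl⟩
    · exact Or.inr ⟨e, by simpa [Nat.lt_succ_iff] using he,
        (Function.LeftInverse.iterate σ.symm_apply_apply e) y⟩
  have h1 := (Finset.card_le_card hsub).trans (Finset.card_union_le _ _)
  have h2 := Finset.card_image_le (s := range (K + 1)) (f := fun e => σ^[e] x)
  have h3 := Finset.card_image_le (s := range (K + 1)) (f := fun e => σ.symm^[e] x)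
  rw [Finset.card_range] at h2 h3
  omega

lemma RobustDigraph.exists_longCycleFactor {G : V → V → Prop} {η ν τ : ℝ}
    (h : RobustDigraph G η ν τ) {m : ℕ} (hm : 1 ≤ m * ν) {Z : Finset V} {K : ℕ}
    (hcard : (Z.card : ℝ) + (m + 2) * (2 * (K + 1)) < ν * Fintype.card V) :
    ∃ σ D, LongCycleFactor G Z K σ D ∧ D.card ≤ 1 := by
  suffices H : ∀ (d : ℕ) (σ : Equiv.Perm V) (D : Finset V), LongCycleFactor G Z K σ D →
      D.card = d → ∃ σ D, LongCycleFactor G Z K σ D ∧ D.card ≤ 1 from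
    H _ 1 Zᶜ ⟨fun v _ => rfl, by simp, by simp +contextual,
      fun v hv j _ _ _ => ⟨0, by simpa using hv⟩⟩ rfl
  intro d
  induction d with
  | zero => exact fun σ D hσ hD => ⟨σ, D, hσ, by omega⟩
  | succ d ih =>
    intro σ D hσ hD
    by_cases hd : d = 0
    · exact ⟨σ, D, hσ, by omega⟩
    obtain ⟨b, hb, b', hb', hbb'⟩ := Finset.one_lt_card.1 (show 1 < D.card by omega)
    have hN := card_orbitClose_le σ K
    set N : V → Finset V := fun x => univ.filter fun y => OrbitClose σ K x y with hNdef
    have hXc : ((Z ∪ (N b ∪ N b')).card : ℝ) ≤ Z.card + 4 * (K + 1) := by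
      have h1 := Finset.card_union_le Z (N b ∪ N b')
      have h2 := Finset.card_union_le (N b) (N b')
      have h3 : (N b).card ≤ 2 * (K + 1) := hN b
      have h4 : (N b').card ≤ 2 * (K + 1) := hN b'
      exact_mod_cast (by omega : (Z ∪ (N b ∪ N b')).card ≤ Z.card + 4 * (K + 1))
    obtain ⟨l, hl, hlk, hav, hp⟩ := (h.comp_perm σ).exists_link (C := OrbitClose σ K) hN hm b b'
      (X := Z ∪ (N b ∪ N b')) (by push_cast; nlinarith)
    simp only [hNdef, Finset.mem_union, Finset.mem_filter, Finset.mem_univ, true_and, not_or]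
      at hav
    have hrefl : ∀ x, OrbitClose σ K x x := fun x => ⟨0, Nat.zero_le _, Or.inl rfl⟩
    have hnd : (b :: (l ++ [b'])).Nodup := by
      rw [List.nodup_cons, List.nodup_append]
      refine ⟨?_, hp.imp fun {x y} h (e : x = y) => h (e ▸ hrefl x), by simp, ?_⟩
      · simp only [List.mem_append, List.mem_singleton, not_or]
        exact ⟨fun hc => (hav b hc).2.1 (hrefl b), hbb'⟩
      · intro x hx y hy e
        rw [List.mem_singleton.1 hy] at e
        exact (hav x hx).2.2 (e ▸ hrefl x)
    refine ih _ _ (hσ.rotate hb' hbb' ?_ hlk ?_ hnd ?_) (by rw [Finset.card_erase_of_mem hb]; omega)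
    · rintro rfl
      simp only [List.length_nil] at hl
      subst hl
      norm_num at hm
    · intro v hv
      simp only [List.mem_cons, List.mem_append, List.not_mem_nil, or_false] at hv
      rcases hv with rfl | hv | rfl
      · exact hσ.notMem _ hb
      · exact (hav v hv).1
      · exact hσ.notMem _ hb'
    · have : Std.Symm fun x y => ¬ OrbitClose σ K y x := ⟨fun _ _ h e => h e.symm⟩
      have H : ∀ x ∈ l, ∀ y ∈ b :: (l ++ [b']), x ≠ y → ¬ OrbitClose σ K x y := by
        intro x hx y hy hxy hc
        simp only [List.mem_cons, List.mem_append, List.not_mem_nil, or_false] at hy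
        rcases hy with rfl | hy | rfl
        · exact (hav x hx).2.1 hc.symm
        · exact hp.forall hy hx hxy.symm hc
        · exact (hav x hx).2.2 hc.symm
      intro x hx y hy hxy hxyl hc
      rcases hxyl with h1 | h1
      · exact H x h1 y hy hxy hc
      · exact H y h1 x hx hxy.symm hc.symm

end LongCycles

section Orbits

variable {V : Type*}

/-- The orbit of `v` under `f`, listed from `v` on. -/
noncomputable def orbitList (f : V → V) (v : V) : List V :=
  (List.range (Function.minimalPeriod f v)).map fun i => f^[i] v

lemma nodup_orbitList (f : V → V) (v : V) : (orbitList f v).Nodup := by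
  refine List.Nodup.map_on (fun i hi j hj hij => ?_) List.nodup_range
  exact Function.iterate_injOn_Iio_minimalPeriod (by simpa using hi) (by simpa using hj) hij

variable [Finite V] {G : V → V → Prop} {σ : Equiv.Perm V}

lemma minimalPeriod_perm_pos (σ : Equiv.Perm V) (v : V) : 0 < Function.minimalPeriod σ v :=
  Function.minimalPeriod_pos_of_mem_periodicPts (σ.injective.mem_periodicPts v)

lemma mem_orbitList {v w : V} : w ∈ orbitList σ v ↔ ∃ i, σ^[i] v = w := by
  simp only [orbitList, List.mem_map, List.mem_range]
  refine ⟨fun ⟨i, _, hi⟩ => ⟨i, hi⟩, fun ⟨i, hi⟩ => ⟨i % Function.minimalPeriod σ v, ?_, ?_⟩⟩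
  · exact Nat.mod_lt _ (minimalPeriod_perm_pos σ v)
  · rw [Function.iterate_mod_minimalPeriod_eq, hi]

lemma mem_orbitList_of_apply_mem {v w : V} (h : σ w ∈ orbitList σ v) : w ∈ orbitList σ v := by
  rw [mem_orbitList] at h ⊢
  obtain ⟨i, hi⟩ := h
  refine ⟨i + (Function.minimalPeriod σ v - 1), σ.injective ?_⟩
  rw [← Function.iterate_succ_apply' σ, ← hi]
  have := minimalPeriod_perm_pos σ v
  rw [show (i + (Function.minimalPeriod σ v - 1)).succ = i + Function.minimalPeriod σ v by omega,
    Function.iterate_add_apply, Function.iterate_minimalPeriod]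

lemma diPath_orbitList {v : V}
    (h : ∀ i, i + 1 < Function.minimalPeriod σ v → G (σ^[i] v) (σ (σ^[i] v))) :
    ∃ u w, DiPath G u w (orbitList σ v) := by
  have hpos := minimalPeriod_perm_pos σ v
  have hne : orbitList σ v ≠ [] := by
    rw [← List.length_pos_iff]
    simpa [orbitList] using hpos
  refine ⟨_, _, List.isChain_iff_getElem.2 fun i hi => ?_, List.head?_eq_some_head hne,
    List.getLast?_eq_some_getLast hne⟩
  have := h i (by simpa [orbitList] using hi)
  simpa [orbitList, Function.iterate_succ_apply' (σ : V → V)] using this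

lemma exists_paths_of_invariant {K : ℕ} (W : Finset V) (hinv : ∀ v ∈ W, σ v ∈ W)
    (hedge : ∀ v ∈ W, G v (σ v)) (hlong : ∀ v ∈ W, ∀ j, 0 < j → j < K → σ^[j] v ≠ v) :
    ∃ Qs : List (List V), (∀ Q ∈ Qs, ∃ u w, DiPath G u w Q) ∧ Qs.flatten.Nodup ∧
      (∀ v, v ∈ Qs.flatten ↔ v ∈ W) ∧ Qs.length * K ≤ W.card := by
  induction W using Finset.strongInduction with
  | H W ih =>
    rcases W.eq_empty_or_nonempty with rfl | ⟨v, hv⟩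
    · exact ⟨[], by simp⟩
    have hit : ∀ i, σ^[i] v ∈ W := by
      intro i
      induction i with
      | zero => exact hv
      | succ i ih' =>
        rw [Function.iterate_succ_apply']
        exact hinv _ ih'
    have hsub : (orbitList σ v).toFinset ⊆ W := by
      intro w hw
      obtain ⟨i, rfl⟩ := mem_orbitList.1 (List.mem_toFinset.1 hw)
      exact hit i
    have hcard : (orbitList σ v).toFinset.card = Function.minimalPeriod σ v := by
      rw [List.toFinset_card_of_nodup (nodup_orbitList _ _)]
      simp [orbitList]
    have hK : K ≤ Function.minimalPeriod σ v := by
      by_contra! hc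
      exact hlong v hv _ (minimalPeriod_perm_pos σ v) hc Function.iterate_minimalPeriod
    have hvmem : v ∈ (orbitList σ v).toFinset :=
      List.mem_toFinset.2 (mem_orbitList.2 ⟨0, rfl⟩)
    obtain ⟨Qs, hQ, hnd, hmem, hlen⟩ := ih (W \ (orbitList σ v).toFinset)
      (Finset.sdiff_ssubset hsub ⟨v, hvmem⟩)
      (fun w hw => by
        simp only [Finset.mem_sdiff, List.mem_toFinset] at hw ⊢
        exact ⟨hinv w hw.1, fun hc => hw.2 (mem_orbitList_of_apply_mem hc)⟩)
      (fun w hw => hedge w (Finset.mem_sdiff.1 hw).1)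
      (fun w hw => hlong w (Finset.mem_sdiff.1 hw).1)
    refine ⟨orbitList σ v :: Qs, ?_, ?_, ?_, ?_⟩
    · intro Q hQ'
      rcases List.mem_cons.1 hQ' with rfl | hQ'
      · exact diPath_orbitList fun i _ => hedge _ (hit i)
      · exact hQ Q hQ'
    · rw [List.flatten_cons, List.nodup_append]
      refine ⟨nodup_orbitList _ _, hnd, ?_⟩
      rintro a ha c hc rfl
      have := (hmem a).1 hc
      simp [ha] at this
    · intro w
      rw [List.flatten_cons, List.mem_append, hmem, Finset.mem_sdiff, List.mem_toFinset]
      have := @hsub w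
      rw [List.mem_toFinset] at this
      tauto
    · rw [Finset.card_sdiff_of_subset hsub, hcard] at hlen
      have := Finset.card_le_card hsub
      rw [hcard] at this
      rw [List.length_cons, Nat.add_mul, Nat.one_mul]
      omega

lemma LongCycleFactor.exists_paths [Fintype V] {Z D : Finset V} {K : ℕ}
    (h : LongCycleFactor G Z K σ D) (hD : D.card ≤ 1) :
    ∃ Qs : List (List V), (∀ Q ∈ Qs, ∃ u w, DiPath G u w Q) ∧ Qs.flatten.Nodup ∧
      (∀ v, v ∈ Qs.flatten ↔ v ∉ Z) ∧ Qs.length * K ≤ Fintype.card V + K := by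
  have hinv : ∀ v, v ∉ Z → σ v ∉ Z := by
    intro v hv hc
    have := σ.injective (h.fixed _ hc)
    exact hv (this ▸ hc)
  rcases D.eq_empty_or_nonempty with rfl | ⟨d, hd⟩
  · obtain ⟨Qs, hQ, hnd, hmem, hlen⟩ := exists_paths_of_invariant (G := G) (σ := σ) (K := K) Zᶜ
      (by simpa using hinv) (by simpa using h.edge) (fun v hv j hj hjK hc => by
        simpa using h.short v (by simpa using hv) j hj hjK hc)
    refine ⟨Qs, hQ, hnd, by simpa using hmem, hlen.trans ?_⟩
    exact (Finset.card_le_univ _).trans (Nat.le_add_right _ _)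
  · obtain rfl : D = {d} :=
      (Finset.eq_of_subset_of_card_le (by simpa using hd) (by simpa using hD)).symm
    have hdZ := h.notMem d hd
    have horb : ∀ v ∈ orbitList σ (σ d), v ∉ Z := by
      intro v hv
      obtain ⟨i, rfl⟩ := mem_orbitList.1 hv
      induction i with
      | zero => exact hinv _ hdZ
      | succ i ih =>
        rw [Function.iterate_succ_apply']
        exact hinv _ (ih (mem_orbitList.2 ⟨i, rfl⟩))
    have hdmem : d ∈ orbitList σ (σ d) :=
      mem_orbitList_of_apply_mem (mem_orbitList.2 ⟨0, rfl⟩)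
    have hback : ∀ i v, σ^[i] v ∈ orbitList σ (σ d) → v ∈ orbitList σ (σ d) := by
      intro i
      induction i with
      | zero => exact fun v hv => hv
      | succ i ih =>
        intro v hv
        rw [Function.iterate_succ_apply'] at hv
        exact ih v (mem_orbitList_of_apply_mem hv)
    obtain ⟨Qs, hQ, hnd, hmem, hlen⟩ := exists_paths_of_invariant (G := G) (σ := σ) (K := K)
      (Zᶜ \ (orbitList σ (σ d)).toFinset)
      (fun v hv => by
        simp only [Finset.mem_sdiff, Finset.mem_compl, List.mem_toFinset] at hv ⊢
        exact ⟨hinv v hv.1, fun hc => hv.2 (mem_orbitList_of_apply_mem hc)⟩)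
      (fun v hv => by
        simp only [Finset.mem_sdiff, Finset.mem_compl, List.mem_toFinset] at hv
        refine h.edge v hv.1 fun hc => hv.2 ?_
        rw [Finset.mem_singleton.1 hc]
        exact hdmem)
      (fun v hv j hj hjK hc => by
        simp only [Finset.mem_sdiff, Finset.mem_compl, List.mem_toFinset] at hv
        obtain ⟨i, hi⟩ := h.short v hv.1 j hj hjK hc
        exact hv.2 (hback i v (Finset.mem_singleton.1 hi ▸ hdmem)))
    refine ⟨orbitList σ (σ d) :: Qs, ?_, ?_, ?_, ?_⟩
    · intro Q hQ'
      rcases List.mem_cons.1 hQ' with rfl | hQ'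
      · refine diPath_orbitList fun i hi => h.edge _ ?_ ?_
        · exact horb _ (mem_orbitList.2 ⟨i, rfl⟩)
        · intro hc
          have h1 : σ^[i + 1] (σ d) = σ d := by
            rw [Function.iterate_succ_apply', Finset.mem_singleton.1 hc]
          have := Function.IsPeriodicPt.minimalPeriod_le (Nat.succ_pos i) h1
          omega
      · exact hQ Q hQ'
    · rw [List.flatten_cons, List.nodup_append]
      refine ⟨nodup_orbitList _ _, hnd, ?_⟩
      rintro a ha c hc rfl
      have := (hmem a).1 hc
      simp [ha] at this
    · intro w
      rw [List.flatten_cons, List.mem_append, hmem, Finset.mem_sdiff, List.mem_toFinset,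
        Finset.mem_compl]
      have := horb w
      tauto
    · have := Finset.card_le_univ (Zᶜ \ (orbitList σ (σ d)).toFinset)
      rw [List.length_cons, Nat.add_mul, Nat.one_mul]
      omega

end Orbits

section Closing

variable {V : Type*} {G : V → V → Prop}

lemma DiPath.append_link {a b c : V} {l m : List V} (h : DiPath G a b l) (e : Link G b m c) :
    ∃ x, DiPath G a x (l ++ m) ∧ G x c := by
  induction m generalizing b l with
  | nil => exact ⟨b, by simpa using h, by simpa [Link] using e⟩
  | cons x m ih =>
    have e' : G b x ∧ Link G x m c := by simpa [Link] using e
    simpa using ih (h.append e'.1 (DiPath.singleton x)) e'.2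

lemma DiPath.hasDiHamCycle [Fintype V] {a b : V} {l : List V} (h : DiPath G a b l) (e : G b a)
    (hnd : l.Nodup) (hl : ∀ v, v ∈ l) : HasDiHamCycle G := by
  have hlen : l.length = Fintype.card V := by
    rw [← List.toFinset_card_of_nodup hnd, ← Finset.card_univ]
    congr 1
    ext v
    simp [hl]
  have hpos : 0 < Fintype.card V := Fintype.card_pos_iff.2 ⟨a⟩
  have : NeZero (Fintype.card V) := ⟨hpos.ne'⟩
  have hlt : ∀ i : ZMod (Fintype.card V), i.val < l.length := fun i =>
    i.val_lt.trans_eq hlen.symm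
  let f : ZMod (Fintype.card V) → V := fun i => l[i.val]'(hlt i)
  have hf : Function.Bijective f := by
    rw [Fintype.bijective_iff_injective_and_card]
    refine ⟨fun i j hij => ZMod.val_injective _ (hnd.getElem_inj_iff.1 hij), ZMod.card _⟩
  refine ⟨Equiv.ofBijective f hf, fun i => ?_⟩
  have hval : (i + 1).val = (i.val + 1) % l.length := by
    rw [ZMod.val_add, ZMod.val_one_eq_one_mod, Nat.add_mod_mod, hlen]
  change G (l[i.val]'(hlt i)) (l[(i + 1).val]'(hlt (i + 1)))
  by_cases hi : i.val + 1 < l.length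
  · simp only [hval, Nat.mod_eq_of_lt hi]
    exact List.isChain_iff_getElem.1 h.1 _ hi
  · have hi' : i.val = l.length - 1 := by
      have := hlt i
      omega
    have h0 : (i.val + 1) % l.length = 0 := by
      rw [show i.val + 1 = l.length by have := hlt i; omega, Nat.mod_self]
    have hb : l[l.length - 1]'(by omega) = b := by
      have := h.2.2
      rw [List.getLast?_eq_getElem?, List.getElem?_eq_some_iff] at this
      exact this.2
    have ha : l[0]'(by omega) = a := by
      have := h.2.1
      rw [List.head?_eq_getElem?, List.getElem?_eq_some_iff] at this
      exact this.2
    have h1 : l[i.val]'(hlt i) = b := by simp only [hi', hb]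
    have h2 : l[(i + 1).val]'(hlt (i + 1)) = a := by simp only [hval, h0, ha]
    rwa [h1, h2]

lemma RobustDigraph.hasDiHamCycle [Fintype V] {η ν τ : ℝ} (h : RobustDigraph G η ν τ) {m : ℕ}
    (hm : 1 ≤ m * ν) (hodd : Odd m) (hloop : ∀ v, ¬ G v v) {r R K : ℕ} (hK : 0 < K)
    (hr : Fintype.card V + K ≤ r * K)
    (hR : (1 - (η / 2) ^ 2) ^ R * (Fintype.card V : ℝ) ^ 2 < 1)
    (hcard : (4 : ℝ) + 2 * (r * ((R + 1) * (m + 4) ^ 2)) + m + (m + 2) * (2 * (K + 1)) <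
      ν * Fintype.card V) : HasDiHamCycle G := by
  have hm0 : (0 : ℝ) ≤ m := Nat.cast_nonneg _
  have hK0 : (0 : ℝ) ≤ (m + 2) * (2 * K) := by positivity
  have hr0 : (0 : ℝ) ≤ r * ((R + 1) * (m + 4) ^ 2) := by positivity
  obtain ⟨σ, D, hσ, hD⟩ := h.exists_longCycleFactor hm (Z := ∅) (K := 0) (by
    simp only [Finset.card_empty, Nat.cast_zero]
    linarith)
  have hD' : (D.card : ℝ) ≤ 1 := by exact_mod_cast hD
  obtain ⟨a, b, A, hA, hAnd, -, hAlen, habs⟩ := h.exists_absorber hm hodd hloop (σ := σ) (X := D)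
    (fun v hv => hσ.edge v (by simp) hv) hR r (by linarith)
  have hAlen' : (A.length : ℝ) ≤ r * ((R + 1) * (m + 4) ^ 2) + 1 := by exact_mod_cast hAlen
  have hAc : (A.toFinset.card : ℝ) ≤ A.length := by exact_mod_cast List.toFinset_card_le A
  obtain ⟨l, hl, hlk, hlA, hlnd⟩ := h.exists_nodup_link hm b a (X := A.toFinset) (by linarith)
  have hZc := card_union_toFinset_le A.toFinset l
  rw [hl] at hZc
  obtain ⟨ρ, D', hρ, hD''⟩ := h.exists_longCycleFactor hm (Z := A.toFinset ∪ l.toFinset) (K := K)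
    (by linarith)
  obtain ⟨Qs, hQ, hQnd, hQmem, hQlen⟩ := hρ.exists_paths hD''
  obtain ⟨A', hA', hperm⟩ := habs Qs (Nat.le_of_mul_le_mul_right (hQlen.trans hr) hK) hQ
  obtain ⟨x, hx, hxa⟩ := hA'.append_link hlk
  simp only [List.mem_toFinset, Finset.mem_union, not_or] at hlA hQmem
  refine hx.hasDiHamCycle hxa ?_ ?_
  · rw [(hperm.append_right l).nodup_iff, List.nodup_append, List.nodup_append]
    refine ⟨⟨hAnd, hQnd, ?_⟩, hlnd, ?_⟩
    · rintro c hc d hd rfl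
      exact ((hQmem c).1 hd).1 hc
    · rintro c hc d hd rfl
      rcases List.mem_append.1 hc with hc | hc
      · exact hlA c hd hc
      · exact ((hQmem c).1 hc).2 hd
  · intro v
    rw [(hperm.append_right l).mem_iff, List.mem_append, List.mem_append, hQmem]
    tauto

end Closing

section Parameters

open Filter

lemma eventually_pow_floor_mul_sq_lt_one {q δ : ℝ} (hq : 0 < q) (hq1 : q < 1) (hδ : 0 < δ) :
    ∀ᶠ n : ℕ in atTop, q ^ ⌊δ * n⌋₊ * (n : ℝ) ^ 2 < 1 := by
  have h1 := tendsto_pow_const_mul_const_pow_of_abs_lt_one 2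
    (show |q| < 1 by rwa [abs_of_pos hq])
  have hfl : Tendsto (fun n : ℕ => ⌊δ * n⌋₊ + 1) atTop atTop :=
    (tendsto_add_atTop_nat 1).comp (tendsto_nat_floor_atTop.comp
      (tendsto_natCast_atTop_atTop.const_mul_atTop hδ))
  filter_upwards [(h1.comp hfl).eventually (gt_mem_nhds (show 0 < q * δ ^ 2 by positivity))]
    with n hn
  have h2 := (Nat.lt_floor_add_one (δ * n)).le
  simp only [Function.comp_apply] at hn
  push_cast at hn
  have h3 : (δ * n) ^ 2 ≤ ((⌊δ * n⌋₊ : ℝ) + 1) ^ 2 :=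
    pow_le_pow_left₀ (by positivity) h2 2
  have h4 : q ^ (⌊δ * n⌋₊ + 1) * (δ * n) ^ 2 < q * δ ^ 2 := by
    refine lt_of_le_of_lt ?_ hn
    rw [mul_comm]
    gcongr
  have h5 : q * δ ^ 2 * (q ^ ⌊δ * n⌋₊ * (n : ℝ) ^ 2) < q * δ ^ 2 * 1 := by
    calc _ = q ^ (⌊δ * n⌋₊ + 1) * (δ * n) ^ 2 := by ring
      _ < _ := by rwa [mul_one]
  exact lt_of_mul_lt_mul_left h5 (by positivity)

lemma exists_odd_one_le_mul {ν : ℝ} (hν : 0 < ν) : ∃ m : ℕ, Odd m ∧ 1 ≤ m * ν := by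
  obtain ⟨k, hk⟩ := exists_nat_ge (1 / ν)
  refine ⟨2 * k + 1, odd_two_mul_add_one k, ?_⟩
  rw [div_le_iff₀ hν] at hk
  push_cast
  nlinarith [Nat.cast_nonneg (α := ℝ) k]

lemma eventually_exists_parameters {η ν : ℝ} (hη0 : 0 < η) (hη1 : η < 1) (hν : 0 < ν) (m : ℕ) :
    ∀ᶠ n : ℕ in atTop, ∃ r R K : ℕ, 0 < K ∧ n + K ≤ r * K ∧
      (1 - (η / 2) ^ 2) ^ R * (n : ℝ) ^ 2 < 1 ∧
      (4 : ℝ) + 2 * (r * ((R + 1) * (m + 4) ^ 2)) + m + (m + 2) * (2 * (K + 1)) < ν * n := by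
  have hm0 : (0 : ℝ) ≤ m := Nat.cast_nonneg _
  obtain ⟨c, hc, hcν⟩ : ∃ c : ℝ, 0 < c ∧ (m + 2) * (2 * c) = ν / 4 :=
    ⟨ν / (8 * (m + 2)), by positivity, by field_simp; norm_num⟩
  obtain ⟨k, hk⟩ := exists_nat_ge (2 / c)
  rw [div_le_iff₀ hc] at hk
  obtain ⟨r, hr⟩ : ∃ r, r = k + 1 := ⟨_, rfl⟩
  have hr0 : (0 : ℝ) < r := by exact_mod_cast (by omega : 0 < r)
  obtain ⟨δ, hδ, hδν⟩ : ∃ δ : ℝ, 0 < δ ∧ 2 * (r * (δ * (m + 4) ^ 2)) = ν / 4 :=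
    ⟨ν / (8 * (r * (m + 4) ^ 2)), by positivity, by field_simp; norm_num⟩
  have hlin : Tendsto (fun n : ℕ => ν * (n : ℝ)) atTop atTop :=
    tendsto_natCast_atTop_atTop.const_mul_atTop hν
  have hlinc : Tendsto (fun n : ℕ => c * (n : ℝ)) atTop atTop :=
    tendsto_natCast_atTop_atTop.const_mul_atTop hc
  filter_upwards [eventually_pow_floor_mul_sq_lt_one (q := 1 - (η / 2) ^ 2) (by nlinarith)
    (by nlinarith) hδ, hlinc.eventually_ge_atTop 2,
    hlin.eventually_gt_atTop (2 * (4 + 2 * (r * (m + 4) ^ 2) + m + (m + 2) * 2))]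
    with n hn hcn hνn
  have hfK := Nat.lt_floor_add_one (c * n)
  have hfK' := Nat.floor_le (show 0 ≤ c * n by positivity)
  have hfR := Nat.floor_le (show 0 ≤ δ * n by positivity)
  refine ⟨r, ⌊δ * n⌋₊, ⌊c * n⌋₊, Nat.floor_pos.2 (by linarith), ?_, hn, ?_⟩
  · have h1 : c * n / 2 ≤ ⌊c * n⌋₊ := by linarith
    have h2 : (n : ℝ) ≤ k * ⌊c * n⌋₊ := by
      have h3 := mul_le_mul_of_nonneg_left h1 (Nat.cast_nonneg (α := ℝ) k)
      have h4 := mul_le_mul_of_nonneg_right hk (Nat.cast_nonneg (α := ℝ) n)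
      linarith
    have h3 : n ≤ k * ⌊c * n⌋₊ := by exact_mod_cast h2
    rw [hr, Nat.add_mul, Nat.one_mul]
    omega
  · have h1 : 2 * (r * (⌊δ * n⌋₊ * ((m : ℝ) + 4) ^ 2)) ≤ ν / 4 * n := by
      rw [← hδν]
      calc _ ≤ 2 * (r * (δ * n * ((m : ℝ) + 4) ^ 2)) := by gcongr
        _ = _ := by ring
    have h2 : ((m : ℝ) + 2) * (2 * ⌊c * n⌋₊) ≤ ν / 4 * n := by
      rw [← hcν]
      calc _ ≤ ((m : ℝ) + 2) * (2 * (c * n)) := by gcongr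
        _ = _ := by ring
    linarith

end Parameters

/-- **Hamilton cycles in robust outexpanders (Kühn–Osthus–Treglown).** Every
sufficiently large digraph with minimum semidegree at least `ηn` which is a robust
`(ν,τ)`-outexpander contains a directed Hamilton cycle. -/
theorem robust_outexpander_hamilton (η : ℝ) (hη0 : 0 < η) (hη1 : η < 1) :
    ∃ τ₀ : ℝ, 0 < τ₀ ∧ ∀ τ : ℝ, 0 < τ → τ ≤ τ₀ → ∀ ν : ℝ, 0 < ν → ν ≤ τ →
    ∃ n₀ : ℕ, ∀ (V : Type) [Fintype V] (G : V → V → Prop),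
      (∀ v : V, ¬ G v v) →
      n₀ ≤ Fintype.card V →
      (∀ v : V, η * (Fintype.card V : ℝ) ≤ (outDeg G v : ℝ) ∧
        η * (Fintype.card V : ℝ) ≤ (inDeg G v : ℝ)) →
      RobustOutexpander G ν τ →
      HasDiHamCycle G := by
  refine ⟨η / 2, by positivity, fun τ _ hτ ν hν hντ => ?_⟩
  obtain ⟨m, hodd, hm⟩ := exists_odd_one_le_mul hν
  obtain ⟨n₀, hn₀⟩ := Filter.eventually_atTop.1 (eventually_exists_parameters hη0 hη1 hν m)
  refine ⟨n₀, fun V _ G hloop hn hdeg hexp => ?_⟩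
  obtain ⟨r, R, K, hK, hr, hR, hcard⟩ := hn₀ _ hn
  have h : RobustDigraph G η ν τ :=
    ⟨hν, hντ, by linarith, fun v => (hdeg v).1, fun v => (hdeg v).2, hexp⟩
  exact h.hasDiHamCycle hm hodd hloop hK hr hR hcard
end

section
/- Approximate version of the Nash-Williams conjecture: For every η ∈ (0,1) there exists an integer n₀ such that the following holds. Let G be a digraph on n ≥ n₀ vertices whose out-degree sequence d⁺₁ ≤ ⋯ ≤ d⁺ₙ and in-degree sequence d⁻₁ ≤ ⋯ ≤ d⁻ₙ satisfy, for every integer i with 1 ≤ i < n/2: (i) d⁺_i ≥ i + ηn or d⁻_{n−i−⌊ηn⌋} ≥ n − i, and (ii) d⁻_i ≥ i + ηn or d⁺_{n−i−⌊ηn⌋} ≥ n − i. Then G contains a directed Hamilton cycle. -/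
open Finset
open scoped Classical

/-- The vertices receiving at least `d` edges from `S`. -/
noncomputable def richOut {V : Type*} [Fintype V] (G : V → V → Prop) (d : ℕ)
    (S : Finset V) : Finset V :=
  univ.filter fun v => d ≤ (S.filter fun s => G s v).card

/-- Minimum semidegree at least `D + d`, and every set of at least `D` vertices expands
robustly (by `d`) along out-edges and along in-edges. -/
structure Expander {V : Type*} [Fintype V] (G : V → V → Prop) (D d : ℕ) : Prop where
  out_deg : ∀ v, D + d ≤ (univ.filter fun y => G v y).card
  in_deg : ∀ v, D + d ≤ (univ.filter fun y => G y v).card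
  out_exp : ∀ S : Finset V, D ≤ S.card →
    richOut G d S = univ ∨ S.card + d ≤ (richOut G d S).card
  in_exp : ∀ S : Finset V, D ≤ S.card →
    richOut (flip G) d S = univ ∨ S.card + d ≤ (richOut (flip G) d S).card

theorem Expander.flip {V : Type*} [Fintype V] {G : V → V → Prop} {D d : ℕ}
    (h : Expander G D d) : Expander (flip G) D d :=
  ⟨h.in_deg, h.out_deg, h.in_exp, h.out_exp⟩

/-- The two alternatives of the Nash-Williams condition, phrased by counting vertices of
large degree. -/
def DegreeAlternative {V : Type*} [Fintype V] (d₁ d₂ : V → ℕ) (m : ℕ) : Prop :=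
  ∀ i : ℕ, 1 ≤ i → 2 * i < Fintype.card V →
    Fintype.card V < (univ.filter fun v => i + m ≤ d₁ v).card + i ∨
    i + m < (univ.filter fun v => Fintype.card V ≤ d₂ v + i).card

theorem le_card_filter_of_monotone {V : Type*} [Fintype V] (f : V → ℕ)
    (e : Fin (Fintype.card V) ≃ V) (he : Monotone fun i => f (e i))
    (j : Fin (Fintype.card V)) (t : ℕ) (hj : t ≤ f (e j)) :
    Fintype.card V ≤ (univ.filter fun v => t ≤ f v).card + j := by
  have h1 : (Finset.Ici j).map e.toEmbedding ⊆ univ.filter fun v => t ≤ f v := by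
    intro v hv
    simp only [mem_map, mem_Ici, Equiv.coe_toEmbedding] at hv
    obtain ⟨i, hi, rfl⟩ := hv
    simp only [mem_filter, mem_univ, true_and]
    exact hj.trans (he hi)
  have h2 := card_le_card h1
  rw [card_map, Fin.card_Ici] at h2
  omega

theorem degreeAlternative_of_sequences {V : Type*} [Fintype V] (d₁ d₂ : V → ℕ) (η : ℝ)
    (hη0 : 0 < η) (m : ℕ) (hm : (m : ℝ) ≤ η * Fintype.card V)
    (hm4 : 4 * m ≤ Fintype.card V) (hn : η * Fintype.card V + 2 ≤ Fintype.card V)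
    (e₁ e₂ : Fin (Fintype.card V) ≃ V)
    (h₁ : Monotone fun i => d₁ (e₁ i)) (h₂ : Monotone fun i => d₂ (e₂ i))
    (h : ∀ i : Fin (Fintype.card V), 2 * ((i : ℕ) + 1) < Fintype.card V →
        ((((i : ℕ) + 1 : ℕ) : ℝ) + η * (Fintype.card V : ℝ) ≤ (d₁ (e₁ i) : ℝ) ∨
          ∀ j : Fin (Fintype.card V),
            (j : ℕ) + 1 = Fintype.card V - ((i : ℕ) + 1) - ⌊η * (Fintype.card V : ℝ)⌋₊ →
            (Fintype.card V : ℝ) - (((i : ℕ) + 1 : ℕ) : ℝ) ≤ (d₂ (e₂ j) : ℝ))) :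
    DegreeAlternative d₁ d₂ m := by
  intro i hi1 hi2
  set M := ⌊η * (Fintype.card V : ℝ)⌋₊ with hM
  have hηn : (0 : ℝ) ≤ η * Fintype.card V := by positivity
  have hmM : m ≤ M := Nat.le_floor hm
  have hMle : (M : ℝ) ≤ η * Fintype.card V := Nat.floor_le hηn
  have hM2 : M + 2 ≤ Fintype.card V := by
    have : ((M + 2 : ℕ) : ℝ) ≤ Fintype.card V := by push_cast; linarith
    exact_mod_cast this
  -- apply the hypothesis at the largest index up to `i` for which it is not vacuous
  obtain ⟨i', hi', hi'1, hi'M, hcase⟩ :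
      ∃ i', i' ≤ i ∧ 1 ≤ i' ∧ i' + M + 1 ≤ Fintype.card V ∧
        (i' = i ∨ i' + M + 1 = Fintype.card V) := by
    by_cases hc : i + M + 1 ≤ Fintype.card V
    · exact ⟨i, le_rfl, hi1, hc, Or.inl rfl⟩
    · exact ⟨Fintype.card V - M - 1, by omega, by omega, by omega, Or.inr (by omega)⟩
  have hlt : i' - 1 < Fintype.card V := by omega
  have key := h ⟨i' - 1, hlt⟩ (by simp only; omega)
  have hsub : i' - 1 + 1 = i' := by omega
  simp only [hsub] at key
  rcases key with key | key
  · left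
    have hdeg : i' + M ≤ d₁ (e₁ ⟨i' - 1, hlt⟩) := by
      have : ((i' + M : ℕ) : ℝ) ≤ (d₁ (e₁ ⟨i' - 1, hlt⟩) : ℝ) := by push_cast; linarith
      exact_mod_cast this
    have := le_card_filter_of_monotone d₁ e₁ h₁ ⟨i' - 1, hlt⟩ (i + m) (by omega)
    simp only at this
    omega
  · right
    have hj : Fintype.card V - i' - M - 1 < Fintype.card V := by omega
    have hdeg := key ⟨Fintype.card V - i' - M - 1, hj⟩ (by simp only; omega)
    have hdeg' : Fintype.card V - i ≤ d₂ (e₂ ⟨Fintype.card V - i' - M - 1, hj⟩) := by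
      have : (Fintype.card V : ℝ) ≤ ((d₂ (e₂ ⟨Fintype.card V - i' - M - 1, hj⟩) + i' : ℕ) : ℝ) := by
        push_cast; linarith
      have : Fintype.card V ≤ d₂ (e₂ ⟨Fintype.card V - i' - M - 1, hj⟩) + i' := by
        exact_mod_cast this
      omega
    have := le_card_filter_of_monotone d₂ e₂ h₂ ⟨Fintype.card V - i' - M - 1, hj⟩
      (Fintype.card V - i) hdeg'
    have hfil : (univ.filter fun v => Fintype.card V - i ≤ d₂ v) =
        univ.filter fun v => Fintype.card V ≤ d₂ v + i := by
      ext v; simp only [mem_filter, mem_univ, true_and]; omega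
    rw [hfil] at this
    simp only at this
    omega

theorem card_filter_add_le {V : Type*} [Fintype V] (S : Finset V) (p : V → Prop)
    [DecidablePred p] :
    (univ.filter p).card + S.card ≤ (S.filter p).card + Fintype.card V := by
  have h1 : (univ.filter p).card = (S.filter p).card + (Sᶜ.filter p).card := by
    rw [← card_union_of_disjoint]
    · rw [← filter_union, union_compl]
    · exact disjoint_filter_filter disjoint_compl_right
  have h2 : (Sᶜ.filter p).card ≤ Sᶜ.card := card_filter_le _ _
  have h3 := card_add_card_compl S
  omega

theorem mul_le_of_forall_le_outDeg {V : Type*} [Fintype V] (G : V → V → Prop) (d k : ℕ)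
    (S S' : Finset V) (hS : S' ⊆ S) (hk : ∀ v ∈ S', k ≤ outDeg G v) :
    S'.card * k ≤ S'.card * (richOut G d S).card + Fintype.card V * d := by
  have h1 : S'.card * k ≤ ∑ v ∈ S', outDeg G v := by
    rw [← smul_eq_mul]; exact card_nsmul_le_sum _ _ _ hk
  have h2 : ∑ v ∈ S', outDeg G v = ∑ t : V, (S'.filter fun s => G s t).card := by
    simp only [outDeg]
    exact sum_card_bipartiteAbove_eq_sum_card_bipartiteBelow (s := S') (t := univ) G
  have h3 : ∀ t : V, (S'.filter fun s => G s t).card ≤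
      (if t ∈ richOut G d S then S'.card else 0) + d := by
    intro t
    split_ifs with ht
    · exact (card_filter_le _ _).trans (Nat.le_add_right _ _)
    · simp only [richOut, mem_filter, mem_univ, true_and, not_le] at ht
      have := card_le_card (filter_subset_filter (fun s => G s t) hS)
      omega
  have h4 := sum_le_sum fun t (_ : t ∈ (univ : Finset V)) => h3 t
  rw [sum_add_distrib, sum_ite_mem, univ_inter, sum_const, sum_const, smul_eq_mul,
    smul_eq_mul, card_univ, mul_comm (richOut G d S).card] at h4
  omega

theorem DegreeAlternative.lt_outDeg {V : Type*} [Fintype V] {G : V → V → Prop} {m : ℕ}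
    (h : DegreeAlternative (outDeg G) (inDeg G) m) (hn : 3 ≤ Fintype.card V)
    (hG : ∀ v, ¬ G v v) (v : V) : m < outDeg G v := by
  rcases h 1 le_rfl (by omega) with h | h
  · have : (univ.filter fun v => 1 + m ≤ outDeg G v) = univ := by
      rw [← card_eq_iff_eq_univ]
      have := card_le_univ (univ.filter fun v => 1 + m ≤ outDeg G v)
      omega
    have := (filter_eq_self.1 this) v (mem_univ v)
    omega
  · have hsub : (univ.filter fun u => Fintype.card V ≤ inDeg G u + 1) ⊆
        insert v (univ.filter fun u => G v u) := by
      intro u hu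
      simp only [mem_filter, mem_univ, true_and, mem_insert] at hu ⊢
      have hdef : inDeg G u = (univ.filter fun y => G y u).card := rfl
      by_contra hcon
      push Not at hcon
      have : (univ.filter fun y => G y u) ⊆ (univ.erase u).erase v := by
        intro y hy
        simp only [mem_filter, mem_univ, true_and, mem_erase, and_true] at hy ⊢
        exact ⟨fun h => hcon.2 (h ▸ hy), fun h => hG u (h ▸ hy)⟩
      have := card_le_card this
      rw [card_erase_of_mem (by simp [Ne.symm hcon.1]), card_erase_of_mem (mem_univ _),
        card_univ, Nat.sub_sub] at this
      omega
    have := card_le_card hsub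
    have := card_insert_le v (univ.filter fun u => G v u)
    simp only [outDeg]
    omega

theorem DegreeAlternative.card_richOut {V : Type*} [Fintype V] {G : V → V → Prop} {e d : ℕ}
    (h₁ : DegreeAlternative (outDeg G) (inDeg G) (4 * e))
    (h₂ : DegreeAlternative (inDeg G) (outDeg G) (4 * e))
    (hin : ∀ v, 4 * e < inDeg G v) (he : 1 ≤ e) (hde : d ≤ e)
    (hd : Fintype.card V * d ≤ e * e) (S : Finset V) (hS : e + 1 ≤ S.card) :
    richOut G d S = univ ∨ S.card + d ≤ (richOut G d S).card := by
  have hcard := card_le_univ S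
  -- vertices of large in-degree are rich
  have rich : ∀ k : ℕ, Fintype.card V + d ≤ k + S.card →
      (univ.filter fun v => k ≤ inDeg G v) ⊆ richOut G d S := by
    intro k hk v hv
    simp only [richOut, mem_filter, mem_univ, true_and] at hv ⊢
    have hdef : inDeg G v = (univ.filter fun s => G s v).card := rfl
    have := card_filter_add_le S (fun s => G s v)
    omega
  have mass : ∀ k : ℕ, ∀ x : ℕ, e + 1 ≤ x →
      x + Fintype.card V ≤ (univ.filter fun v => k ≤ outDeg G v).card + S.card →
      k ≤ (richOut G d S).card + e := by
    intro k x hx hk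
    have h3 := card_filter_add_le S (fun v => k ≤ outDeg G v)
    have h4 := mul_le_of_forall_le_outDeg G d k S (S.filter fun v => k ≤ outDeg G v)
      (filter_subset _ _) (fun v hv => (mem_filter.1 hv).2)
    by_contra hcon
    push Not at hcon
    have h5 : (S.filter fun v => k ≤ outDeg G v).card * ((richOut G d S).card + e + 1) ≤
      (S.filter fun v => k ≤ outDeg G v).card * k := Nat.mul_le_mul_left _ hcon
    have h6 : e * e ≤ (S.filter fun v => k ≤ outDeg G v).card * e :=
      Nat.mul_le_mul_right _ (by omega)
    nlinarith
  by_cases hs : 2 * S.card < Fintype.card V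
  · right
    rcases h₁ (S.card - e) (by omega) (by omega) with h | h
    · have := mass (S.card - e + 4 * e) (e + 1) le_rfl (by omega)
      omega
    · have h7 : (univ.filter fun v => Fintype.card V ≤ inDeg G v + (S.card - e)) ⊆
          richOut G d S := by
        refine (fun v hv => rich (Fintype.card V - (S.card - e)) (by omega) ?_)
        simp only [mem_filter, mem_univ, true_and] at hv ⊢
        omega
      have := card_le_card h7
      omega
  by_cases hs2 : S.card + 2 * e < Fintype.card V
  · right
    rcases h₂ (Fintype.card V - S.card - 2 * e) (by omega) (by omega) with h | h
    · have := card_le_card (rich (Fintype.card V - S.card - 2 * e + 4 * e) (by omega))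
      omega
    · have hfil : (univ.filter fun v => Fintype.card V ≤
          outDeg G v + (Fintype.card V - S.card - 2 * e)) =
          univ.filter fun v => S.card + 2 * e ≤ outDeg G v := by
        ext v; simp only [mem_filter, mem_univ, true_and]; omega
      rw [hfil] at h
      have := mass (S.card + 2 * e) (e + 1) le_rfl (by omega)
      omega
  · left
    rw [eq_univ_iff_forall]
    intro v
    refine rich (4 * e + 1) (by omega) ?_
    simp only [mem_filter, mem_univ, true_and]
    exact hin v

theorem DegreeAlternative.expander {V : Type*} [Fintype V] {G : V → V → Prop} {e d : ℕ}
    (h₁ : DegreeAlternative (outDeg G) (inDeg G) (4 * e))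
    (h₂ : DegreeAlternative (inDeg G) (outDeg G) (4 * e))
    (hn : 3 ≤ Fintype.card V) (hG : ∀ v, ¬ G v v) (he : 1 ≤ e) (hde : d ≤ e)
    (hd : Fintype.card V * d ≤ e * e) : Expander G (e + 1) d := by
  have hout : ∀ v, 4 * e < outDeg G v := fun v => h₁.lt_outDeg hn hG v
  have hin : ∀ v, 4 * e < inDeg G v := fun v =>
    DegreeAlternative.lt_outDeg (G := flip G) h₂ hn hG v
  refine ⟨fun v => ?_, fun v => ?_, fun S hS => ?_, fun S hS => ?_⟩
  · have := hout v
    simp only [outDeg] at this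
    omega
  · have := hin v
    simp only [inDeg] at this
    omega
  · exact h₁.card_richOut h₂ hin he hde hd S hS
  · exact DegreeAlternative.card_richOut (G := flip G) h₂ h₁ hout he hde hd S hS

/-- `l` is a directed path from `u` to `v`. -/
structure IsPathList {V : Type*} (G : V → V → Prop) (u v : V) (l : List V) : Prop where
  head : l.head? = some u
  last : l.getLast? = some v
  chain : l.IsChain G
  nodup : l.Nodup

/-- The list `A` can absorb every path from `a` to `b` disjoint from it: the vertices of both
can be rearranged into a chain with the same ends as `A`. -/
def CanAbsorb {V : Type*} (G : V → V → Prop) (A : List V) (a b : V) : Prop :=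
  ∀ P, IsPathList G a b P → A.Disjoint P →
    ∃ A' : List V, A'.Perm (A ++ P) ∧ A'.IsChain G ∧ A'.head? = A.head? ∧
      A'.getLast? = A.getLast?

theorem IsPathList.ne_nil {V : Type*} {G : V → V → Prop} {u v : V} {l : List V}
    (h : IsPathList G u v l) : l ≠ [] := by
  rintro rfl
  simpa using h.head

theorem isChain_append_of_edge {V : Type*} {G : V → V → Prop} {u v : V} {l₁ l₂ : List V}
    (h₁ : l₁.IsChain G) (h₂ : l₂.IsChain G) (hu : l₁.getLast? = some u)
    (hv : l₂.head? = some v) (huv : G u v) : (l₁ ++ l₂).IsChain G := by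
  rw [List.isChain_append]
  refine ⟨h₁, h₂, ?_⟩
  rw [hu, hv]
  rintro x hx y hy
  simp only [Option.mem_def, Option.some.injEq] at hx hy
  exact hx ▸ hy ▸ huv

theorem IsPathList.append {V : Type*} {G : V → V → Prop} {a b c d : V} {l₁ l₂ : List V}
    (h₁ : IsPathList G a b l₁) (h₂ : IsPathList G c d l₂) (hbc : G b c)
    (hd : l₁.Disjoint l₂) : IsPathList G a d (l₁ ++ l₂) where
  head := by rw [List.head?_append, h₁.head]; rfl
  last := by rw [List.getLast?_append, h₂.last]; rfl
  chain := isChain_append_of_edge h₁.chain h₂.chain h₁.last h₂.head hbc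
  nodup := h₁.nodup.append h₂.nodup hd

theorem IsPathList.singleton {V : Type*} {G : V → V → Prop} (a : V) :
    IsPathList G a a [a] where
  head := rfl
  last := rfl
  chain := List.isChain_singleton a
  nodup := List.nodup_singleton a

theorem canAbsorb_concat {V : Type*} {G : V → V → Prop} {s x y a b : V} {S : List V}
    (hS : IsPathList G s x S) (hb : G b y) (ha : G x a) : CanAbsorb G (S ++ [y]) a b := by
  intro P hP _
  refine ⟨S ++ (P ++ [y]), ?_, ?_, ?_, ?_⟩
  · rw [List.append_assoc]
    exact List.Perm.append_left S List.perm_append_comm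
  · refine isChain_append_of_edge hS.chain ?_ hS.last (v := a) ?_ ha
    · exact isChain_append_of_edge hP.chain (List.isChain_singleton y) hP.last rfl hb
    · rw [List.head?_append, hP.head]; rfl
  · simp [List.head?_append, hS.head]
  · simp

theorem CanAbsorb.extend {V : Type*} {G : V → V → Prop} {s x₁ y₁ x₂ y₂ a b : V}
    {S₀ S₁ A : List V} (hA : CanAbsorb G A a x₂) (hS₀ : IsPathList G s x₁ S₀)
    (hS₁ : IsPathList G y₁ x₂ S₁) (hAhead : A.head? = some y₂) (hxy : G x₁ y₂)
    (hb : G b y₁) (hdisj : S₁.Disjoint A) : CanAbsorb G (S₀ ++ (S₁ ++ A)) a b := by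
  intro P hP hdP
  simp only [List.disjoint_append_left] at hdP
  have hPS : IsPathList G a x₂ (P ++ S₁) := hP.append hS₁ hb hdP.2.1.symm
  obtain ⟨A', hperm, hchain, hhead, hlast⟩ := hA (P ++ S₁) hPS
    (List.disjoint_append_right.2 ⟨hdP.2.2, hdisj.symm⟩)
  have hlast_ne : A.getLast? ≠ none := by
    intro h
    rw [List.getLast?_eq_none_iff] at h
    simp [h] at hAhead
  obtain ⟨z, hz⟩ := Option.ne_none_iff_exists'.1 hlast_ne
  refine ⟨S₀ ++ A', ?_, ?_, ?_, ?_⟩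
  · rw [List.append_assoc]
    refine List.Perm.append_left S₀ (hperm.trans ?_)
    rw [← List.append_assoc]
    exact List.perm_append_comm.trans (by rw [List.append_assoc])
  · exact isChain_append_of_edge hS₀.chain hchain hS₀.last (hhead.trans hAhead) hxy
  · simp [List.head?_append, hS₀.head]
  · simp [List.getLast?_append, hlast, hz]

/-- The set of vertices robustly reachable from `u` in `j + 1` steps. -/
noncomputable def reach {V : Type*} [Fintype V] (G : V → V → Prop) (d : ℕ) (u : V) :
    ℕ → Finset V
  | 0 => univ.filter fun y => G u y
  | j + 1 => richOut G d (reach G d u j)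

/-- The set of vertices from which an absorber ending its alternating path at `x` can be built
with `j` extensions. -/
noncomputable def reachAlt {V : Type*} [Fintype V] (G : V → V → Prop) (d : ℕ) (x : V) :
    ℕ → Finset V
  | 0 => univ.filter fun y => G x y
  | j + 1 => richOut G d (richOut (flip G) d (richOut G d (richOut (flip G) d
      (reachAlt G d x j))))

theorem Expander.min_le_card_richOut {V : Type*} [Fintype V] {G : V → V → Prop} {D d k : ℕ}
    (h : Expander G D d) {S : Finset V} (hS : min (Fintype.card V) (D + k) ≤ S.card)
    (hD : D ≤ Fintype.card V) :
    min (Fintype.card V) (D + (k + d)) ≤ (richOut G d S).card := by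
  rcases h.out_exp S (by omega) with h | h
  · rw [h, card_univ]; omega
  · omega

theorem Expander.reach_eq_univ {V : Type*} [Fintype V] {G : V → V → Prop} {D d J : ℕ}
    (h : Expander G D d) (hJ : Fintype.card V ≤ J * d) (u : V) : reach G d u J = univ := by
  have hD : D ≤ Fintype.card V := by
    have := h.out_deg u
    have := card_le_univ (univ.filter fun y => G u y)
    omega
  have key : ∀ j, min (Fintype.card V) (D + j * d) ≤ (reach G d u j).card := by
    intro j
    induction j with
    | zero =>
      have := h.out_deg u
      simp only [reach]
      omega
    | succ j ih => rw [add_mul, one_mul]; exact h.min_le_card_richOut ih hD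
  rw [← card_eq_iff_eq_univ]
  have := key J
  have := card_le_univ (reach G d u J)
  omega

theorem Expander.reachAlt_eq_univ {V : Type*} [Fintype V] {G : V → V → Prop} {D d J : ℕ}
    (h : Expander G D d) (hJ : Fintype.card V ≤ J * d) (x : V) :
    reachAlt G d x J = univ := by
  have hD : D ≤ Fintype.card V := by
    have := h.out_deg x
    have := card_le_univ (univ.filter fun y => G x y)
    omega
  have key : ∀ j, min (Fintype.card V) (D + j * d) ≤ (reachAlt G d x j).card := by
    intro j
    induction j with
    | zero =>
      have := h.out_deg x
      simp only [reachAlt]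
      omega
    | succ j ih =>
      have := h.min_le_card_richOut (h.flip.min_le_card_richOut
        (h.min_le_card_richOut (h.flip.min_le_card_richOut ih hD) hD) hD) hD
      rw [add_mul, one_mul]
      simp only [reachAlt]
      omega
  rw [← card_eq_iff_eq_univ]
  have := key J
  have := card_le_univ (reachAlt G d x J)
  omega

theorem exists_edge_of_mem_richOut {V : Type*} [Fintype V] {G : V → V → Prop} {d : ℕ}
    {S : Finset V} {v : V} (hv : v ∈ richOut G d S) (U : Finset V) (hU : U.card < d) :
    ∃ w ∈ S, G w v ∧ w ∉ U := by
  simp only [richOut, mem_filter, mem_univ, true_and] at hv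
  obtain ⟨w, hw, hwU⟩ := exists_mem_notMem_of_card_lt_card (hU.trans_le hv)
  rw [mem_filter] at hw
  exact ⟨w, hw.1, hw.2, hwU⟩

theorem exists_path_of_mem_reach {V : Type*} [Fintype V] {G : V → V → Prop} {d : ℕ} (u : V)
    (j : ℕ) : ∀ (v : V) (U : Finset V), v ∈ reach G d u j → u ∉ U → v ∉ U → u ≠ v →
      U.card + j + 2 ≤ d →
      ∃ l, IsPathList G u v l ∧ (∀ x ∈ l, x ∉ U) ∧ l.length ≤ j + 2 := by
  induction j with
  | zero =>
    intro v U hv hu hvU huv _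
    simp only [reach, mem_filter, mem_univ, true_and] at hv
    refine ⟨[u] ++ [v], (IsPathList.singleton u).append (IsPathList.singleton v) hv ?_, ?_, ?_⟩
    · simpa using huv.symm
    · simp [hu, hvU]
    · simp
  | succ j ih =>
    intro v U hv hu hvU huv hd
    have hc1 := card_insert_le v U
    have hc2 := card_insert_le u (insert v U)
    obtain ⟨w, hw, hwv, hwU⟩ := exists_edge_of_mem_richOut hv (insert u (insert v U)) (by omega)
    simp only [mem_insert, not_or] at hwU
    obtain ⟨l, hl, hlU, hlen⟩ := ih w (insert v U) hw (by simp [huv, hu])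
      (by simp [hwU]) (Ne.symm hwU.1) (by omega)
    refine ⟨l ++ [v], hl.append (IsPathList.singleton v) hwv ?_, ?_, ?_⟩
    · simp only [List.disjoint_singleton]
      exact fun hmem => hlU v hmem (mem_insert_self _ _)
    · simp only [List.mem_append, List.mem_singleton]
      rintro x (hx | rfl)
      · exact fun hxU => hlU x hx (mem_insert_of_mem hxU)
      · exact hvU
    · simp; omega

theorem Expander.exists_path {V : Type*} [Fintype V] {G : V → V → Prop} {D d J : ℕ}
    (h : Expander G D d) (hJ : Fintype.card V ≤ J * d) {u v : V} (U : Finset V)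
    (hu : u ∉ U) (hv : v ∉ U) (huv : u ≠ v) (hU : U.card + J + 2 ≤ d) :
    ∃ l, IsPathList G u v l ∧ (∀ x ∈ l, x ∉ U) ∧ l.length ≤ J + 2 :=
  exists_path_of_mem_reach u J v U (by rw [h.reach_eq_univ hJ]; exact mem_univ _) hu hv huv hU

theorem Expander.exists_absorber_of_mem {V : Type*} [Fintype V] {G : V → V → Prop}
    {D d J : ℕ} (h : Expander G D d) (hJ : Fintype.card V ≤ J * d) (x : V) (j : ℕ) :
    ∀ (s y : V) (U : Finset V), y ∈ reachAlt G d x j → s ∉ U → y ∉ U → x ∉ U → s ≠ y →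
      s ≠ x → y ≠ x → U.card + (2 * J + 20) * (j + 1) ≤ d →
      ∃ A : List V, A.head? = some s ∧ A.IsChain G ∧ A.Nodup ∧ (∀ z ∈ A, z ∉ U) ∧
        A.length ≤ (2 * J + 20) * (j + 1) ∧ ∀ a b, G b y → G x a → CanAbsorb G A a b := by
  induction j with
  | zero =>
    intro s y U hy hs hyU hx hsy hsx hyx hU
    simp only [reachAlt, mem_filter, mem_univ, true_and] at hy
    have hc := card_insert_le y U
    obtain ⟨S, hS, hSU, hSlen⟩ := h.exists_path hJ (u := s) (v := x) (insert y U)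
      (by simp [hsy, hs]) (by simp [hyx.symm, hx]) hsx (by omega)
    have hp := hS.append (IsPathList.singleton y) hy (by
      simp only [List.disjoint_singleton]
      exact fun hmem => hSU y hmem (mem_insert_self _ _))
    refine ⟨S ++ [y], hp.head, hp.chain, hp.nodup, ?_, ?_, ?_⟩
    · simp only [List.mem_append, List.mem_singleton]
      rintro z (hz | rfl)
      · exact fun hzU => hSU z hz (mem_insert_of_mem hzU)
      · exact hyU
    · simp; omega
    · exact fun a b hb ha => canAbsorb_concat hS hb ha
  | succ j ih =>
    intro s y U hy hs hyU hx hsy hsx hyx hU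
    have hU' : U.card + (2 * J + 20) * (j + 1) + (2 * J + 20) ≤ d := by
      nlinarith
    have card4 : ∀ (a b c e : V) (W : Finset V),
        (insert a (insert b (insert c (insert e W)))).card ≤ W.card + 4 := by
      intro a b c e W
      have := card_insert_le a (insert b (insert c (insert e W)))
      have := card_insert_le b (insert c (insert e W))
      have := card_insert_le c (insert e W)
      have := card_insert_le e W
      omega
    obtain ⟨x₁, hx₁, hx₁y, hx₁U⟩ := exists_edge_of_mem_richOut hy
      (insert s (insert y (insert x (insert x U)))) (by
        have := card4 s y x x U; omega)
    obtain ⟨y₂, hy₂, hy₂x, hy₂U⟩ := exists_edge_of_mem_richOut hx₁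
      (insert s (insert y (insert x (insert x₁ U)))) (by
        have := card4 s y x x₁ U; omega)
    obtain ⟨x₂, hx₂, hx₂y, hx₂U⟩ := exists_edge_of_mem_richOut hy₂
      (insert s (insert y (insert x (insert x₁ (insert y₂ U))))) (by
        have := card4 s y x x₁ (insert y₂ U)
        have := card_insert_le y₂ U
        omega)
    obtain ⟨y₃, hy₃, hy₃x, hy₃U⟩ := exists_edge_of_mem_richOut hx₂
      (insert s (insert y (insert x (insert x₁ (insert y₂ (insert x₂ U)))))) (by
        have := card4 s y x x₁ (insert y₂ (insert x₂ U))
        have := card_insert_le y₂ (insert x₂ U)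
        have := card_insert_le x₂ U
        omega)
    simp only [mem_insert, not_or] at hx₁U hy₂U hx₂U hy₃U
    change G x₁ y₂ at hy₂x
    change G x₂ y₃ at hy₃x
    obtain ⟨S₀, hS₀, hS₀U, hS₀len⟩ := h.exists_path hJ (u := s) (v := x₁)
      (insert y (insert y₂ (insert x₂ (insert y₃ (insert x U)))))
      (by simp only [mem_insert, not_or]; tauto) (by simp only [mem_insert, not_or]; tauto)
      (by tauto) (by
        have := card4 y y₂ x₂ y₃ (insert x U)
        have := card_insert_le x U
        omega)
    simp only [mem_insert, not_or] at hS₀U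
    have hS₀c := List.toFinset_card_le S₀
    have hU₁ := card_union_le S₀.toFinset U
    obtain ⟨S₁, hS₁, hS₁U, hS₁len⟩ := h.exists_path hJ (u := y) (v := x₂)
      (insert y₂ (insert y₃ (insert x (insert x (S₀.toFinset ∪ U)))))
      (by
        simp only [mem_insert, mem_union, List.mem_toFinset, not_or]
        have := fun hm => (hS₀U y hm).1 rfl
        tauto)
      (by
        simp only [mem_insert, mem_union, List.mem_toFinset, not_or]
        have := fun hm => (hS₀U x₂ hm).2.2.1 rfl
        tauto)
      (by tauto) (by
        have := card4 y₂ y₃ x x (S₀.toFinset ∪ U)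
        omega)
    simp only [mem_insert, mem_union, List.mem_toFinset, not_or] at hS₁U
    have hS₁c := List.toFinset_card_le S₁
    have hU₂ := card_union_le S₁.toFinset (S₀.toFinset ∪ U)
    have hnot : ∀ z, (z = y₂ ∨ z = y₃ ∨ z = x) → z ∉ S₀ ∧ z ∉ S₁ := by
      intro z hz
      refine ⟨fun hm => ?_, fun hm => ?_⟩
      · have := hS₀U z hm; tauto
      · have := hS₁U z hm; tauto
    obtain ⟨A, hAhead, hAchain, hAnodup, hAU, hAlen, hA⟩ := ih y₂ y₃
      (S₁.toFinset ∪ (S₀.toFinset ∪ U)) hy₃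
      (by
        simp only [mem_union, List.mem_toFinset, not_or]
        have := hnot y₂ (by tauto)
        tauto)
      (by
        simp only [mem_union, List.mem_toFinset, not_or]
        have := hnot y₃ (by tauto)
        tauto)
      (by
        simp only [mem_union, List.mem_toFinset, not_or]
        have := hnot x (by tauto)
        tauto)
      (Ne.symm hy₃U.2.2.2.2.1) hy₂U.2.2.1 hy₃U.2.2.1 (by omega)
    simp only [mem_union, List.mem_toFinset, not_or] at hAU
    have hd₁ : S₁.Disjoint A := fun z h₁ h₂ => (hAU z h₂).1 h₁
    have hd₀ : S₀.Disjoint (S₁ ++ A) := by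
      rw [List.disjoint_append_right]
      exact ⟨fun z h₀ h₁ => (hS₁U z h₁).2.2.2.2.1 h₀, fun z h₀ h₂ => (hAU z h₂).2.1 h₀⟩
    refine ⟨S₀ ++ (S₁ ++ A), ?_, ?_, ?_, ?_, ?_, ?_⟩
    · simp [List.head?_append, hS₀.head]
    · refine isChain_append_of_edge hS₀.chain (isChain_append_of_edge hS₁.chain hAchain
        hS₁.last hAhead hx₂y) hS₀.last (v := y) ?_ hx₁y
      simp [List.head?_append, hS₁.head]
    · exact hS₀.nodup.append (hS₁.nodup.append hAnodup hd₁) hd₀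
    · simp only [List.mem_append]
      rintro z (hz | hz | hz)
      · exact (hS₀U z hz).2.2.2.2.2
      · exact (hS₁U z hz).2.2.2.2.2
      · exact (hAU z hz).2.2
    · simp only [List.length_append]
      have : (2 * J + 20) * (j + 1 + 1) = (2 * J + 20) * (j + 1) + (2 * J + 20) := by ring
      omega
    · exact fun a b hb ha => (hA a x₂ hy₃x ha).extend hS₀ hS₁ hAhead hy₂x hb hd₁

theorem Expander.exists_absorber {V : Type*} [Fintype V] {G : V → V → Prop}
    {D d J : ℕ} (h : Expander G D d) (hJ : Fintype.card V ≤ J * d) {s x y : V} (U : Finset V)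
    (hs : s ∉ U) (hy : y ∉ U) (hx : x ∉ U) (hsy : s ≠ y) (hsx : s ≠ x) (hyx : y ≠ x)
    (hU : U.card + (2 * J + 20) * (J + 1) ≤ d) :
    ∃ A : List V, A.head? = some s ∧ A.IsChain G ∧ A.Nodup ∧ (∀ z ∈ A, z ∉ U) ∧
      A.length ≤ (2 * J + 20) * (J + 1) ∧ ∀ a b, G b y → G x a → CanAbsorb G A a b :=
  h.exists_absorber_of_mem hJ x J s y U (by rw [h.reachAlt_eq_univ hJ]; exact mem_univ _)
    hs hy hx hsy hsx hyx hU

theorem exists_popular {V : Type*} [Fintype V] [Nonempty V] (R : V → V → Prop) (D : ℕ)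
    (hD : 1 ≤ D) (U : Finset V) (hR : ∀ b, D + U.card ≤ (univ.filter fun y => R b y).card)
    (W : V → ℝ) (hW : ∀ b, 0 ≤ W b) :
    ∃ y, y ∉ U ∧ D * ∑ b, W b ≤ Fintype.card V * ∑ b with R b y, W b := by
  have hdeg : ∀ b, D ≤ (Uᶜ.filter fun y => R b y).card := by
    intro b
    have h1 := card_filter_add_le Uᶜ (fun y => R b y)
    have h2 := card_add_card_compl U
    have h3 := hR b
    omega
  have hne : Uᶜ.Nonempty := by
    obtain ⟨b⟩ := ‹Nonempty V›
    have := hdeg b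
    have := card_filter_le Uᶜ (fun y => R b y)
    rw [← card_pos]
    omega
  have hW0 : 0 ≤ ∑ b, W b := sum_nonneg fun b _ => hW b
  obtain ⟨y, hy, hle⟩ := exists_le_of_sum_le (s := Uᶜ) (f := fun _ => (D : ℝ) * ∑ b, W b)
    (g := fun y => (Fintype.card V : ℝ) * ∑ b with R b y, W b) hne (by
      rw [sum_const, nsmul_eq_mul, ← mul_sum]
      have h1 : ∑ y ∈ Uᶜ, ∑ b with R b y, W b =
          ∑ b, ((Uᶜ.filter fun y => R b y).card : ℝ) * W b := by
        simp only [sum_filter]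
        rw [sum_comm]
        refine sum_congr rfl fun b _ => ?_
        rw [← sum_filter, sum_const, nsmul_eq_mul]
      have h2 : (D : ℝ) * ∑ b, W b ≤
          ∑ b, ((Uᶜ.filter fun y => R b y).card : ℝ) * W b := by
        rw [mul_sum]
        exact sum_le_sum fun b _ =>
          mul_le_mul_of_nonneg_right (by exact_mod_cast hdeg b) (hW b)
      rw [h1]
      have h3 : ((Uᶜ : Finset V).card : ℝ) ≤ Fintype.card V := by exact_mod_cast card_le_univ _
      exact mul_le_mul h3 h2 (by positivity) (by positivity))
  exact ⟨y, by simpa using hy, hle⟩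

theorem exists_popular_pair {V : Type*} [Fintype V] [Nonempty V] {G : V → V → Prop} {D d : ℕ}
    (h : Expander G D d) (hD : 1 ≤ D) (U : Finset V) (hU : U.card + 1 ≤ d) (w : V → V → ℝ)
    (hw : ∀ a b, 0 ≤ w a b) :
    ∃ y x, y ∉ U ∧ x ∉ U ∧ y ≠ x ∧
      (D : ℝ) ^ 2 * ∑ a, ∑ b, w a b ≤
        (Fintype.card V : ℝ) ^ 2 * ∑ a with G x a, ∑ b with G b y, w a b := by
  obtain ⟨y, hy, hyle⟩ := exists_popular G D hD U
    (fun b => (Nat.add_le_add_left (by omega) D).trans (h.out_deg b))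
    (fun b => ∑ a, w a b) (fun b => sum_nonneg fun a _ => hw a b)
  have hc := card_insert_le y U
  obtain ⟨x, hx, hxle⟩ := exists_popular (flip G) D hD (insert y U)
    (fun a => (Nat.add_le_add_left (by omega) D).trans (h.in_deg a))
    (fun a => ∑ b with G b y, w a b) (fun a => sum_nonneg fun b _ => hw a b)
  simp only [mem_insert, not_or] at hx
  refine ⟨y, x, hy, hx.2, Ne.symm hx.1, ?_⟩
  have e1 : ∑ b, ∑ a, w a b = ∑ a, ∑ b, w a b := sum_comm
  have e2 : ∑ b with G b y, ∑ a, w a b = ∑ a, ∑ b with G b y, w a b := sum_comm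
  rw [e1, e2] at hyle
  calc (D : ℝ) ^ 2 * ∑ a, ∑ b, w a b = D * (D * ∑ a, ∑ b, w a b) := by ring
    _ ≤ D * (Fintype.card V * ∑ a, ∑ b with G b y, w a b) := by gcongr
    _ = Fintype.card V * (D * ∑ a, ∑ b with G b y, w a b) := by ring
    _ ≤ Fintype.card V * (Fintype.card V * ∑ a with G x a, ∑ b with G b y, w a b) :=
        mul_le_mul_of_nonneg_left hxle (by positivity)
    _ = _ := by ring

/-- The number of lists in `Qs` that can absorb every path from `a` to `b`. -/
noncomputable def absorbCount {V : Type*} (G : V → V → Prop) (Qs : List (List V)) (a b : V) :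
    ℕ :=
  Qs.countP fun Q => decide (CanAbsorb G Q a b)

theorem exists_absorber_family {V : Type*} [Fintype V] [Nonempty V] {G : V → V → Prop}
    {D d J : ℕ} (h : Expander G D d) (hJ : Fintype.card V ≤ J * d) (hD : 1 ≤ D) (T : ℕ) :
    (T + 1) * ((2 * J + 20) * (J + 1)) ≤ d →
    ∃ Qs : List (List V), Qs.length = T ∧ (∀ Q ∈ Qs, Q ≠ []) ∧ Qs.flatten.IsChain G ∧
      Qs.flatten.Nodup ∧ Qs.flatten.length ≤ T * ((2 * J + 20) * (J + 1)) ∧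
      ∑ a, ∑ b, (1 / 2 : ℝ) ^ absorbCount G Qs a b ≤
        (Fintype.card V : ℝ) ^ 2 *
          (1 - (D : ℝ) ^ 2 / (2 * (Fintype.card V : ℝ) ^ 2)) ^ T := by
  induction T with
  | zero =>
    intro _
    refine ⟨[], rfl, by simp, by simp, by simp, by simp, ?_⟩
    simp [absorbCount, sq]
  | succ T ih =>
    intro hT
    set L := (2 * J + 20) * (J + 1) with hL
    have hL1 : 20 ≤ L := by rw [hL]; nlinarith
    have hT' : (T + 1 + 1) * L = T * L + L + L := by ring
    obtain ⟨Qs, hlen, hne, hchain, hnodup, hflen, hsum⟩ := ih (by nlinarith)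
    set U := Qs.flatten.toFinset with hUdef
    have hUc : U.card ≤ T * L := (List.toFinset_card_le _).trans hflen
    obtain ⟨s, hsU, hs⟩ : ∃ s, s ∉ U ∧ ∀ t ∈ Qs.flatten.getLast?, G t s := by
      rcases hg : Qs.flatten.getLast? with _ | t
      · obtain ⟨v⟩ := ‹Nonempty V›
        obtain ⟨s, _, hs⟩ := exists_mem_notMem_of_card_lt_card (s := U)
          (t := univ.filter fun y => G v y) (by have := h.out_deg v; omega)
        exact ⟨s, hs, by simp⟩
      · obtain ⟨s, hst, hs⟩ := exists_mem_notMem_of_card_lt_card (s := U)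
          (t := univ.filter fun y => G t y) (by have := h.out_deg t; omega)
        refine ⟨s, hs, ?_⟩
        simpa using hst
    have hc := card_insert_le s U
    obtain ⟨y, x, hy, hx, hyx, hpop⟩ := exists_popular_pair h hD (insert s U) (by omega)
      (fun a b => (1 / 2 : ℝ) ^ absorbCount G Qs a b) (fun a b => by positivity)
    simp only [mem_insert, not_or] at hy hx
    obtain ⟨A, hAhead, hAchain, hAnodup, hAU, hAlen, hA⟩ := h.exists_absorber hJ U hsU hy.2 hx.2
      (Ne.symm hy.1) (Ne.symm hx.1) hyx (by omega)
    have hAne : A ≠ [] := by rintro rfl; simp at hAhead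
    refine ⟨Qs ++ [A], by simp [hlen], ?_, ?_, ?_, ?_, ?_⟩
    · simp only [List.mem_append, List.mem_singleton]
      rintro Q (hQ | rfl)
      · exact hne Q hQ
      · exact hAne
    · simp only [List.flatten_append, List.flatten_singleton]
      rw [List.isChain_append]
      refine ⟨hchain, hAchain, ?_⟩
      rintro t ht z hz
      rw [hAhead] at hz
      simp only [Option.mem_def, Option.some.injEq] at hz
      exact hz ▸ hs t ht
    · simp only [List.flatten_append, List.flatten_singleton]
      refine hnodup.append hAnodup fun z hz hzA => hAU z hzA ?_
      rw [hUdef, List.mem_toFinset]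
      exact hz
    · simp only [List.flatten_append, List.flatten_singleton, List.length_append]
      have : (T + 1) * L = T * L + L := by ring
      omega
    · have hstep : ∀ a b, (1 / 2 : ℝ) ^ absorbCount G (Qs ++ [A]) a b ≤
          (1 / 2 : ℝ) ^ absorbCount G Qs a b - (1 / 2) *
            (if G x a then (if G b y then (1 / 2 : ℝ) ^ absorbCount G Qs a b else 0) else 0) := by
        intro a b
        have hcount : absorbCount G (Qs ++ [A]) a b =
            absorbCount G Qs a b + if CanAbsorb G A a b then 1 else 0 := by
          simp [absorbCount, List.countP_append, List.countP_singleton]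
        rw [hcount]
        have hpos : (0 : ℝ) < (1 / 2 : ℝ) ^ absorbCount G Qs a b := by positivity
        by_cases hab : G x a ∧ G b y
        · rw [if_pos (hA a b hab.2 hab.1), if_pos hab.1, if_pos hab.2, pow_succ]
          linarith
        · have : (if G x a then (if G b y then (1 / 2 : ℝ) ^ absorbCount G Qs a b else 0)
              else 0) = 0 := by
            split_ifs with h1 h2
            · exact absurd ⟨h1, h2⟩ hab
            · rfl
            · rfl
          rw [this, mul_zero, sub_zero]
          split_ifs
          · rw [pow_succ]; linarith
          · simp
      have hn : (0 : ℝ) < Fintype.card V := by exact_mod_cast Fintype.card_pos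
      set Φ := ∑ a, ∑ b, (1 / 2 : ℝ) ^ absorbCount G Qs a b with hΦ
      have htotal : ∑ a, ∑ b, (1 / 2 : ℝ) ^ absorbCount G (Qs ++ [A]) a b ≤
          Φ - (1 / 2) * ∑ a with G x a, ∑ b with G b y, (1 / 2 : ℝ) ^ absorbCount G Qs a b := by
        refine (sum_le_sum fun a _ => sum_le_sum fun b _ => hstep a b).trans (le_of_eq ?_)
        simp only [sum_sub_distrib, ← mul_sum, sum_filter]
        congr 2
        refine sum_congr rfl fun a _ => ?_
        split_ifs
        · rfl
        · simp
      have hq : 0 ≤ 1 - (D : ℝ) ^ 2 / (2 * (Fintype.card V : ℝ) ^ 2) := by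
        obtain ⟨v⟩ := ‹Nonempty V›
        have h1 : D ≤ Fintype.card V := by
          have := h.out_deg v
          have := card_le_univ (univ.filter fun y => G v y)
          omega
        have h2 : (D : ℝ) ≤ Fintype.card V := by exact_mod_cast h1
        rw [sub_nonneg, div_le_one (by positivity)]
        nlinarith
      calc _ ≤ _ := htotal
        _ ≤ Φ - (1 / 2) * ((D : ℝ) ^ 2 / (Fintype.card V : ℝ) ^ 2 * Φ) := by
            have : (D : ℝ) ^ 2 / (Fintype.card V : ℝ) ^ 2 * Φ ≤
                ∑ a with G x a, ∑ b with G b y, (1 / 2 : ℝ) ^ absorbCount G Qs a b := by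
              rw [div_mul_eq_mul_div, div_le_iff₀ (by positivity)]
              linarith
            linarith
        _ = (1 - (D : ℝ) ^ 2 / (2 * (Fintype.card V : ℝ) ^ 2)) * Φ := by
            field_simp
        _ ≤ (1 - (D : ℝ) ^ 2 / (2 * (Fintype.card V : ℝ) ^ 2)) * ((Fintype.card V : ℝ) ^ 2 *
              (1 - (D : ℝ) ^ 2 / (2 * (Fintype.card V : ℝ) ^ 2)) ^ T) := by gcongr
        _ = _ := by rw [pow_succ]; ring

/-- `l` is a chain that closes up to a cycle. -/
def IsCyclicChain {V : Type*} (G : V → V → Prop) (l : List V) : Prop :=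
  l.IsChain G ∧ ∀ x ∈ l.getLast?, ∀ y ∈ l.head?, G x y

theorem exists_absorbing_cycle {V : Type*} [Fintype V] [Nonempty V] {G : V → V → Prop}
    {D d J : ℕ} (h : Expander G D d) (hJ : Fintype.card V ≤ J * d) (hD : 1 ≤ D) (T : ℕ)
    (hT : 1 ≤ T) (hTd : (T + 1) * ((2 * J + 20) * (J + 1)) ≤ d) :
    ∃ Qs : List (List V), (∀ Q ∈ Qs, Q ≠ []) ∧ IsCyclicChain G Qs.flatten ∧
      Qs.flatten.Nodup ∧ Qs.flatten.length ≤ (T + 1) * ((2 * J + 20) * (J + 1)) ∧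
      ∀ a b, (1 / 2 : ℝ) ^ absorbCount G Qs a b ≤ (Fintype.card V : ℝ) ^ 2 *
          (1 - (D : ℝ) ^ 2 / (2 * (Fintype.card V : ℝ) ^ 2)) ^ T := by
  obtain ⟨Qs, hlen, hne, hchain, hnodup, hflen, hsum⟩ := exists_absorber_family h hJ hD T hTd
  set L := (2 * J + 20) * (J + 1) with hL
  have hL1 : J + 20 ≤ L := by rw [hL]; nlinarith
  have hTL : (T + 1) * L = T * L + L := by ring
  have hfne : Qs.flatten ≠ [] := by
    intro h0
    rw [List.flatten_eq_nil_iff] at h0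
    rcases Qs with _ | ⟨Q, Qs⟩
    · simp at hlen; omega
    · exact hne Q (by simp) (h0 Q (by simp))
  obtain ⟨t, ht⟩ : ∃ t, Qs.flatten.getLast? = some t :=
    ⟨_, List.getLast?_eq_some_getLast hfne⟩
  obtain ⟨s, hs⟩ : ∃ s, Qs.flatten.head? = some s := ⟨_, List.head?_eq_some_head hfne⟩
  have hUc : Qs.flatten.toFinset.card ≤ T * L := (List.toFinset_card_le _).trans hflen
  obtain ⟨w, hw, hwU⟩ := exists_mem_notMem_of_card_lt_card (s := Qs.flatten.toFinset)
    (t := univ.filter fun y => G t y) (by have := h.out_deg t; omega)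
  have hc := card_insert_le w Qs.flatten.toFinset
  obtain ⟨z, hz, hzU⟩ := exists_mem_notMem_of_card_lt_card (s := insert w Qs.flatten.toFinset)
    (t := univ.filter fun y => G y s) (by have := h.in_deg s; omega)
  simp only [mem_insert, not_or] at hzU
  simp only [mem_filter, mem_univ, true_and] at hw hz
  obtain ⟨Z, hZ, hZU, hZlen⟩ := h.exists_path hJ (u := w) (v := z) Qs.flatten.toFinset hwU hzU.2
    (Ne.symm hzU.1) (by omega)
  have hflat : (Qs ++ [Z]).flatten = Qs.flatten ++ Z := by simp
  refine ⟨Qs ++ [Z], ?_, ?_, ?_, ?_, ?_⟩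
  · simp only [List.mem_append, List.mem_singleton]
    rintro Q (hQ | rfl)
    · exact hne Q hQ
    · exact hZ.ne_nil
  · rw [hflat]
    refine ⟨isChain_append_of_edge hchain hZ.chain ht hZ.head hw, ?_⟩
    rw [List.getLast?_append, List.head?_append, hZ.last, hs]
    simpa using hz
  · rw [hflat]
    exact hnodup.append hZ.nodup fun x hx hxZ => hZU x hxZ (List.mem_toFinset.2 hx)
  · rw [hflat, List.length_append]
    omega
  · intro a b
    have h1 : absorbCount G Qs a b ≤ absorbCount G (Qs ++ [Z]) a b := by
      simp [absorbCount, List.countP_append]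
    have h2 : (1 / 2 : ℝ) ^ absorbCount G Qs a b ≤
        ∑ b, (1 / 2 : ℝ) ^ absorbCount G Qs a b :=
      single_le_sum (f := fun b => (1 / 2 : ℝ) ^ absorbCount G Qs a b)
        (fun b _ => by positivity) (mem_univ b)
    have h3 : ∑ b, (1 / 2 : ℝ) ^ absorbCount G Qs a b ≤
        ∑ a, ∑ b, (1 / 2 : ℝ) ^ absorbCount G Qs a b :=
      single_le_sum (f := fun a => ∑ b, (1 / 2 : ℝ) ^ absorbCount G Qs a b)
        (fun a _ => by positivity) (mem_univ a)
    have h4 : (1 / 2 : ℝ) ^ absorbCount G (Qs ++ [Z]) a b ≤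
        (1 / 2 : ℝ) ^ absorbCount G Qs a b :=
      pow_le_pow_of_le_one (by norm_num) (by norm_num) h1
    linarith

theorem IsCyclicChain.replace {V : Type*} {G : V → V → Prop} {B C Q Q' : List V}
    (h : IsCyclicChain G (B ++ (Q ++ C))) (hQ : Q ≠ []) (hchain : Q'.IsChain G)
    (hhead : Q'.head? = Q.head?) (hlast : Q'.getLast? = Q.getLast?) :
    IsCyclicChain G (B ++ (Q' ++ C)) := by
  obtain ⟨s, hs⟩ : ∃ s, Q.head? = some s := ⟨_, List.head?_eq_some_head hQ⟩
  obtain ⟨t, ht⟩ : ∃ t, Q.getLast? = some t := ⟨_, List.getLast?_eq_some_getLast hQ⟩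
  rw [hs] at hhead
  rw [ht] at hlast
  simp only [IsCyclicChain, List.isChain_append, List.head?_append, List.getLast?_append,
    hs, ht, hhead, hlast] at h ⊢
  tauto

theorem exists_cyclicChain_absorbing {V : Type*} {G : V → V → Prop} (Ps : List (List V)) :
    ∀ Qs : List (List V), (∀ Q ∈ Qs, Q ≠ []) → IsCyclicChain G Qs.flatten →
      (Qs.flatten ++ Ps.flatten).Nodup → (∀ P ∈ Ps, P ≠ [] ∧ P.IsChain G) →
      (∀ a b, Ps.length ≤ absorbCount G Qs a b) →
      ∃ l, IsCyclicChain G l ∧ l.Perm (Qs.flatten ++ Ps.flatten) := by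
  induction Ps with
  | nil => intro Qs _ hcyc _ _ _; exact ⟨Qs.flatten, hcyc, by simp⟩
  | cons P Ps ih =>
    intro Qs hne hcyc hnodup hPs hcount
    obtain ⟨hPne, hPchain⟩ := hPs P (by simp)
    have hP : IsPathList G (P.head hPne) (P.getLast hPne) P :=
      ⟨List.head?_eq_some_head hPne, List.getLast?_eq_some_getLast hPne, hPchain, by
        refine hnodup.sublist ?_
        simp only [List.flatten_cons]
        exact (List.sublist_append_left P _).trans (List.sublist_append_right _ _)⟩
    obtain ⟨Q, hQmem, hQ⟩ : ∃ Q ∈ Qs, CanAbsorb G Q (P.head hPne) (P.getLast hPne) := by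
      have h1 := hcount (P.head hPne) (P.getLast hPne)
      have h2 : 0 < absorbCount G Qs (P.head hPne) (P.getLast hPne) := by
        simp only [List.length_cons] at h1; omega
      simpa [absorbCount, List.countP_pos_iff] using h2
    obtain ⟨B, C, rfl⟩ := List.append_of_mem hQmem
    have hdisj : Q.Disjoint P := by
      intro z hzQ hzP
      exact (List.nodup_append'.1 hnodup).2.2
        (List.mem_flatten.2 ⟨Q, hQmem, hzQ⟩) (List.mem_flatten.2 ⟨P, by simp, hzP⟩)
    obtain ⟨Q', hperm, hchain, hhead, hlast⟩ := hQ P hP hdisj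
    have hperm' : ((B ++ Q' :: C).flatten ++ Ps.flatten).Perm
        ((B ++ Q :: C).flatten ++ (P :: Ps).flatten) := by
      simp only [List.flatten_append, List.flatten_cons, List.append_assoc]
      refine List.Perm.append_left _ ?_
      refine (hperm.append_right _).trans ?_
      rw [List.append_assoc]
      refine List.Perm.append_left _ ?_
      rw [← List.append_assoc, ← List.append_assoc]
      exact List.Perm.append_right _ List.perm_append_comm
    obtain ⟨l, hl, hlperm⟩ := ih (B ++ Q' :: C) (by
        intro R hR
        simp only [List.mem_append, List.mem_cons] at hR
        rcases hR with hR | rfl | hR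
        · exact hne R (by simp [hR])
        · rintro rfl
          have := hperm.length_eq
          have := List.length_pos_iff.2 hPne
          simp at *
          omega
        · exact hne R (by simp [hR]))
      (by
        simp only [List.flatten_append, List.flatten_cons] at hcyc ⊢
        exact hcyc.replace (hne Q hQmem) hchain hhead hlast)
      (hperm'.nodup_iff.2 hnodup) (fun R hR => hPs R (by simp [hR]))
      (by
        intro a b
        have h1 := hcount a b
        simp only [absorbCount, List.countP_append, List.countP_cons, List.length_cons] at h1 ⊢
        split_ifs at h1 <;> omega)
    exact ⟨l, hl, hlperm.trans hperm'⟩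

theorem hasDiHamCycle_of_isCyclicChain {V : Type*} [Fintype V] {G : V → V → Prop} {l : List V}
    (hl : IsCyclicChain G l) (hnodup : l.Nodup) (hmem : ∀ v, v ∈ l) (hne : l ≠ []) :
    HasDiHamCycle G := by
  have hcard : Fintype.card V = l.length := by
    rw [← List.toFinset_card_of_nodup hnodup, eq_comm, card_eq_iff_eq_univ, eq_univ_iff_forall]
    exact fun v => List.mem_toFinset.2 (hmem v)
  unfold HasDiHamCycle
  rw [hcard]
  rcases l with _ | ⟨a, t⟩
  · exact absurd rfl hne
  refine ⟨(hnodup.getEquivOfForallMemList _ hmem : Fin (t.length + 1) ≃ V), ?_⟩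
  intro (i : Fin (t.length + 1))
  change G ((a :: t).get i) ((a :: t).get (i + 1))
  by_cases hi : i = Fin.last t.length
  · subst hi
    rw [Fin.last_add_one]
    refine hl.2 _ ?_ _ (by simp)
    simp [List.getLast?_eq_getElem?]
  · have hlt : i < Fin.last t.length := lt_of_le_of_ne (Fin.le_last i) hi
    have hval : (i + 1).val = i.val + 1 := Fin.val_add_one_of_lt hlt
    have := (List.isChain_iff_getElem.1 hl.1) i.val (by
      have : i.val < t.length := hlt
      simpa using this)
    simpa [List.get_eq_getElem, hval] using this

theorem Expander.exists_perm_avoiding {V : Type*} [Fintype V] {G : V → V → Prop} {D d : ℕ}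
    (h : Expander G D d) (U : Finset V) (k : ℕ) (hk : U.card + k < d)
    (τ : ℕ → Equiv.Perm {v // v ∉ U}) :
    ∃ π : Equiv.Perm {v // v ∉ U}, ∀ v : {v // v ∉ U}, G v (π v) ∧ ∀ j < k, π v ≠ τ j v := by
  set t : {v // v ∉ U} → Finset {v // v ∉ U} := fun v =>
    univ.filter fun w => G v w ∧ ∀ j < k, w ≠ τ j v with ht
  have hall : ∀ S : Finset {v // v ∉ U}, S.card ≤ (S.biUnion t).card := by
    intro S
    rcases S.eq_empty_or_nonempty with rfl | ⟨v, hv⟩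
    · simp
    rcases lt_or_ge S.card D with hS | hS
    · have hsub : (univ.filter fun y => G v y) ⊆
          (U ∪ (t v).image Subtype.val) ∪ (range k).image fun j => (τ j v : V) := by
        intro w hw
        simp only [mem_filter, mem_univ, true_and] at hw
        by_cases hwU : w ∈ U
        · simp [hwU]
        by_cases hwτ : ∃ j < k, (τ j v : V) = w
        · obtain ⟨j, hj, rfl⟩ := hwτ
          exact mem_union_right _ (mem_image.2 ⟨j, mem_range.2 hj, rfl⟩)
        · refine mem_union_left _ (mem_union_right _ (mem_image.2 ⟨⟨w, hwU⟩, ?_, rfl⟩))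
          simp only [ht, mem_filter, mem_univ, true_and]
          exact ⟨hw, fun j hj e => hwτ ⟨j, hj, by rw [← e]⟩⟩
      have h1 := card_le_card hsub
      have h2 := card_union_le (U ∪ (t v).image Subtype.val)
        ((range k).image fun j => (τ j v : V))
      have h3 := card_union_le U ((t v).image Subtype.val)
      have h4 : ((t v).image Subtype.val).card ≤ (t v).card := card_image_le
      have h5 : ((range k).image fun j => (τ j v : V)).card ≤ (range k).card := card_image_le
      rw [card_range] at h5
      have h6 := card_le_card (subset_biUnion_of_mem t hv)
      have h7 := h.out_deg v
      omega
    · have hS' : (S.image Subtype.val).card = S.card :=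
        card_image_of_injective _ Subtype.val_injective
      have hsub : richOut G d (S.image Subtype.val) ⊆ U ∪ (S.biUnion t).image Subtype.val := by
        intro w hw
        simp only [richOut, mem_filter, mem_univ, true_and] at hw
        by_cases hwU : w ∈ U
        · simp [hwU]
        have h1 : ((range k).image fun j => ((τ j).symm ⟨w, hwU⟩ : V)).card ≤
            (range k).card := card_image_le
        rw [card_range] at h1
        obtain ⟨s, hs, hsn⟩ := exists_mem_notMem_of_card_lt_card
          (lt_of_le_of_lt h1 (lt_of_lt_of_le (by omega) hw))
        simp only [mem_filter, mem_image] at hs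
        obtain ⟨⟨s, hsS, rfl⟩, hsw⟩ := hs
        refine mem_union_right _ (mem_image.2 ⟨⟨w, hwU⟩, mem_biUnion.2 ⟨s, hsS, ?_⟩, rfl⟩)
        simp only [ht, mem_filter, mem_univ, true_and]
        refine ⟨hsw, fun j hj e => hsn (mem_image.2 ⟨j, mem_range.2 hj, ?_⟩)⟩
        rw [e, Equiv.symm_apply_apply]
      have h1 := card_le_card hsub
      have h2 := card_union_le U ((S.biUnion t).image Subtype.val)
      have h3 : ((S.biUnion t).image Subtype.val).card ≤ (S.biUnion t).card := card_image_le
      rcases h.out_exp (S.image Subtype.val) (by omega) with h4 | h4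
      · rw [h4, card_univ] at h1
        have h5 : Disjoint (S.image Subtype.val) U := by
          rw [disjoint_left]
          rintro _ hx
          obtain ⟨x, -, rfl⟩ := mem_image.1 hx
          exact x.2
        have h6 := card_le_univ (S.image Subtype.val ∪ U)
        rw [card_union_of_disjoint h5] at h6
        omega
      · omega
  obtain ⟨f, hf, hft⟩ := (all_card_le_biUnion_card_iff_exists_injective t).1 hall
  refine ⟨Equiv.ofBijective f (Finite.injective_iff_bijective.1 hf), fun v => ?_⟩
  simpa [ht] using hft v

theorem Expander.exists_disjoint_perms {V : Type*} [Fintype V] {G : V → V → Prop} {D d : ℕ}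
    (h : Expander G D d) (U : Finset V) (r : ℕ) (hr : U.card + r ≤ d) :
    ∃ σ : ℕ → Equiv.Perm {v // v ∉ U},
      ∀ i < r, ∀ v : {v // v ∉ U}, G v (σ i v) ∧ ∀ j < i, σ i v ≠ σ j v := by
  induction r with
  | zero => exact ⟨fun _ => 1, by simp⟩
  | succ r ih =>
    obtain ⟨σ, hσ⟩ := ih (by omega)
    obtain ⟨π, hπ⟩ := h.exists_perm_avoiding U r (by omega) σ
    refine ⟨Function.update σ r π, fun i hi v => ?_⟩
    rcases Nat.lt_succ_iff_lt_or_eq.1 hi with hi | rfl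
    · rw [Function.update_of_ne hi.ne]
      refine ⟨(hσ i hi v).1, fun j hj => ?_⟩
      rw [Function.update_of_ne (hj.trans hi).ne]
      exact (hσ i hi v).2 j hj
    · rw [Function.update_self]
      refine ⟨(hπ v).1, fun j hj => ?_⟩
      rw [Function.update_of_ne hj.ne]
      exact (hπ v).2 j hj

theorem sum_eq_zero_of_sum_update {W : Type*} [Fintype W] {K : ℕ} [NeZero K]
    (F : (W → ZMod K) → ℤ) (u : W) (hF : ∀ f, ∑ c, F (Function.update f u c) = 0) :
    ∑ f, F f = 0 := by
  have h1 : ∀ c : ZMod K, ∑ f, F (f + (Pi.single u c : W → ZMod K)) = ∑ f, F f := fun c : ZMod K =>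
    Fintype.sum_equiv (Equiv.addRight (Pi.single u c : W → ZMod K)) _ _ fun f => rfl
  have h2 : ∀ f : W → ZMod K, ∑ c, F (f + Pi.single u c) = 0 := by
    intro f
    rw [← hF f]
    refine Fintype.sum_equiv (Equiv.addLeft (f u)) _ _ fun c => ?_
    congr 1
    ext x
    by_cases hx : x = u
    · subst hx; simp
    · simp [hx]
  have h3 : ∑ c : ZMod K, ∑ f, F (f + (Pi.single u c : W → ZMod K)) = 0 := by
    rw [sum_comm]; exact sum_eq_zero fun f _ => h2 f
  rw [sum_congr rfl fun (c : ZMod K) _ => h1 c, sum_const, card_univ, ZMod.card, smul_eq_zero] at h3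
  exact h3.resolve_left (NeZero.ne K)

theorem sum_ite_eq_sub_one {K : ℕ} [NeZero K] (b : ZMod K) :
    ∑ c : ZMod K, (if c = b then (K : ℤ) - 1 else -1) = 0 := by
  have h : ∀ c : ZMod K, (if c = b then (K : ℤ) - 1 else -1) =
      (if c = b then (K : ℤ) else 0) - 1 := by
    intro c; split_ifs <;> ring
  simp [h, ZMod.card]

/-- Second moment of the number of vertices `s i` in the class `c + f v` of a uniformly
random colouring `f`. -/
theorem sum_sq_count_le {W : Type*} [Fintype W] {K : ℕ} [NeZero K] (r : ℕ) (s : ℕ → W) (v : W)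
    (c : ZMod K) (hs : ∀ i < r, ∀ j < r, i ≠ j → s i ≠ s j) (hv : ∀ i < r, s i ≠ v) :
    ∑ f : W → ZMod K, (∑ i ∈ range r, (if f (s i) = f v + c then (K : ℤ) - 1 else -1)) ^ 2 ≤
      r * (K : ℤ) ^ 2 * Fintype.card (W → ZMod K) := by
  set X : (W → ZMod K) → ℕ → ℤ := fun f i =>
    if f (s i) = f v + c then (K : ℤ) - 1 else -1 with hX
  have hK : (1 : ℤ) ≤ K := by exact_mod_cast Nat.one_le_iff_ne_zero.2 (NeZero.ne K)
  have hsq : ∀ f i, X f i * X f i ≤ (K : ℤ) ^ 2 := by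
    intro f i
    simp only [hX]
    split_ifs <;> nlinarith
  have h0 : ∀ i < r, ∀ j < r, i ≠ j → ∑ f, X f i * X f j = 0 := by
    intro i hi j hj hij
    refine sum_eq_zero_of_sum_update _ (s i) fun f => ?_
    have h1 : ∀ a, X (Function.update f (s i) a) j = X f j := by
      intro a
      simp only [hX, Function.update_of_ne (hs j hj i hi (Ne.symm hij)),
        Function.update_of_ne (hv i hi).symm]
    have h2 : ∀ a, X (Function.update f (s i) a) i =
        if a = f v + c then (K : ℤ) - 1 else -1 := by
      intro a
      simp only [hX, Function.update_self, Function.update_of_ne (hv i hi).symm]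
    simp only [h1, h2]
    rw [← sum_mul, sum_ite_eq_sub_one, zero_mul]
  have h1 : ∑ f, (∑ i ∈ range r, X f i) ^ 2 =
      ∑ i ∈ range r, ∑ j ∈ range r, ∑ f, X f i * X f j := by
    simp only [sq, sum_mul_sum]
    rw [sum_comm]
    exact sum_congr rfl fun i _ => sum_comm
  rw [h1]
  have h2 : ∀ i ∈ range r, ∑ j ∈ range r, ∑ f, X f i * X f j ≤
      (K : ℤ) ^ 2 * Fintype.card (W → ZMod K) := by
    intro i hi
    rw [sum_eq_single_of_mem i hi fun j hj hji =>
      h0 i (mem_range.1 hi) j (mem_range.1 hj) (Ne.symm hji)]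
    refine (sum_le_card_nsmul univ _ _ fun f _ => hsq f i).trans (le_of_eq ?_)
    rw [card_univ, nsmul_eq_mul, mul_comm]
  refine (sum_le_card_nsmul _ _ _ h2).trans (le_of_eq ?_)
  rw [card_range, nsmul_eq_mul]; ring

/-- There is a colouring such that for most `v` the colour class following that of `v`
contains about `r / K` of the vertices `σ i v`, and similarly for preimages. -/
theorem exists_balanced_colouring {W : Type*} [Fintype W] {K : ℕ} [NeZero K] (r : ℕ)
    (σ : ℕ → Equiv.Perm W) (hσ : ∀ i < r, ∀ j < r, i ≠ j → ∀ v, σ i v ≠ σ j v)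
    (hσ' : ∀ i < r, ∀ v, σ i v ≠ v) :
    ∃ f : W → ZMod K, ∑ v,
      ((∑ i ∈ range r, (if f (σ i v) = f v + 1 then (K : ℤ) - 1 else -1)) ^ 2 +
        (∑ i ∈ range r, (if f ((σ i).symm v) = f v + -1 then (K : ℤ) - 1 else -1)) ^ 2) ≤
      Fintype.card W * (2 * r * (K : ℤ) ^ 2) := by
  have h : ∑ f : W → ZMod K, ∑ v,
      ((∑ i ∈ range r, (if f (σ i v) = f v + 1 then (K : ℤ) - 1 else -1)) ^ 2 +
        (∑ i ∈ range r, (if f ((σ i).symm v) = f v + -1 then (K : ℤ) - 1 else -1)) ^ 2) ≤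
      ∑ f : W → ZMod K, Fintype.card W * (2 * r * (K : ℤ) ^ 2) := by
    rw [sum_comm]
    refine (sum_le_card_nsmul _ _
      (2 * (r * (K : ℤ) ^ 2 * Fintype.card (W → ZMod K))) fun v _ => ?_).trans (le_of_eq ?_)
    · rw [sum_add_distrib, two_mul]
      refine add_le_add (sum_sq_count_le r (fun i => σ i v) v 1
        (fun i hi j hj hij => hσ i hi j hj hij v) fun i hi => hσ' i hi v)
        (sum_sq_count_le r (fun i => (σ i).symm v) v (-1) (fun i hi j hj hij e => ?_)
          fun i hi e => ?_)
      · have := hσ i hi j hj hij ((σ i).symm v)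
        rw [Equiv.apply_symm_apply] at this
        apply this
        rw [show (σ i).symm v = (σ j).symm v from e, Equiv.apply_symm_apply]
      · apply hσ' i hi ((σ i).symm v)
        rw [Equiv.apply_symm_apply]; exact e.symm
    · rw [sum_const, nsmul_eq_mul, nsmul_eq_mul, card_univ, card_univ]; ring
  obtain ⟨f, -, hf⟩ := exists_le_of_sum_le univ_nonempty h
  exact ⟨f, hf⟩

/-- Paths following an injective partial map along which a rank increases: the number of
paths needed is the number of vertices without a successor. -/
theorem exists_path_cover_of_rank {W : Type*} {R : W → W → Prop}
    (hR : ∀ ⦃a b c⦄, R a c → R b c → a = b) (ρ : W → ℕ) (hρ : ∀ ⦃a b⦄, R a b → ρ a < ρ b)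
    (s : Finset W) :
    ∃ Ps : List (List W), (∀ P ∈ Ps, P ≠ [] ∧ P.IsChain R) ∧ Ps.flatten.Nodup ∧
      (∀ x, x ∈ Ps.flatten ↔ x ∈ s) ∧
      (∀ w ∈ s, (∀ v ∈ s, ¬ R v w) → ∃ P, w :: P ∈ Ps) ∧
      Ps.length ≤ (s.filter fun v => ∀ w ∈ s, ¬ R v w).card := by
  induction s using induction_on_min_value ρ with
  | empty => exact ⟨[], by simp⟩
  | insert a s ha hmin ih =>
    obtain ⟨Ps, hP, hnd, hmem, hhead, hlen⟩ := ih
    have hsa : ∀ v ∈ s, ¬ R v a := fun v hv h => absurd (hρ h) (not_lt.2 (hmin v hv))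
    have haa : ¬ R a a := fun h => lt_irrefl _ (hρ h)
    have hle : (s.filter fun v => ∀ w ∈ s, ¬ R v w) ⊆
        (insert a s).filter fun v => ∀ w ∈ insert a s, ¬ R v w := by
      intro v hv
      simp only [mem_filter, mem_insert, forall_eq_or_imp] at hv ⊢
      exact ⟨Or.inr hv.1, hsa v hv.1, hv.2⟩
    by_cases hex : ∃ w ∈ s, R a w
    · obtain ⟨w, hw, haw⟩ := hex
      obtain ⟨P, hPw⟩ := hhead w hw fun v hv hvw => ha (hR hvw haw ▸ hv)
      obtain ⟨Ps₁, Ps₂, rfl⟩ := List.append_of_mem hPw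
      have hperm : (Ps₁ ++ (a :: w :: P) :: Ps₂).flatten.Perm
          (a :: (Ps₁ ++ (w :: P) :: Ps₂).flatten) := by
        simp only [List.flatten_append, List.flatten_cons, List.cons_append]
        exact List.perm_middle
      refine ⟨Ps₁ ++ (a :: w :: P) :: Ps₂, ?_, ?_, ?_, ?_, ?_⟩
      · intro Q hQ
        simp only [List.mem_append, List.mem_cons] at hQ
        rcases hQ with hQ | rfl | hQ
        · exact hP Q (by simp [hQ])
        · exact ⟨by simp, List.isChain_cons_cons.2 ⟨haw, (hP _ hPw).2⟩⟩
        · exact hP Q (by simp [hQ])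
      · rw [hperm.nodup_iff, List.nodup_cons, hmem]
        exact ⟨ha, hnd⟩
      · intro x
        rw [hperm.mem_iff, List.mem_cons, hmem, mem_insert]
      · intro x hx hxR
        rcases mem_insert.1 hx with rfl | hx
        · exact ⟨w :: P, by simp⟩
        · obtain ⟨Q, hQ⟩ := hhead x hx fun v hv => hxR v (mem_insert_of_mem hv)
          have hxw : x ≠ w := by
            rintro rfl
            exact hxR a (mem_insert_self _ _) haw
          refine ⟨Q, ?_⟩
          simp only [List.mem_append, List.mem_cons, List.cons.injEq] at hQ ⊢
          tauto
      · refine le_trans (le_of_eq ?_) (hlen.trans (card_le_card hle))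
        simp
    · push Not at hex
      refine ⟨[a] :: Ps, ?_, ?_, ?_, ?_, ?_⟩
      · intro Q hQ
        rcases List.mem_cons.1 hQ with rfl | hQ
        · simp
        · exact hP Q hQ
      · simp only [List.flatten_cons, List.singleton_append, List.nodup_cons, hmem]
        exact ⟨ha, hnd⟩
      · intro x
        simp only [List.flatten_cons, List.singleton_append, List.mem_cons, hmem, mem_insert]
      · intro x hx hxR
        rcases mem_insert.1 hx with rfl | hx
        · exact ⟨[], by simp⟩
        · obtain ⟨Q, hQ⟩ := hhead x hx fun v hv => hxR v (mem_insert_of_mem hv)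
          exact ⟨Q, List.mem_cons_of_mem _ hQ⟩
      · have h1 : insert a (s.filter fun v => ∀ w ∈ s, ¬ R v w) ⊆
            (insert a s).filter fun v => ∀ w ∈ insert a s, ¬ R v w := by
          refine insert_subset ?_ hle
          simp only [mem_filter, mem_insert, forall_eq_or_imp]
          exact ⟨Or.inl trivial, haa, hex⟩
        have h2 := card_le_card h1
        rw [card_insert_of_notMem (by simp [ha])] at h2
        simp only [List.length_cons]
        omega

theorem exists_partial_matching {W : Type*} [Fintype W] (t : W → Finset W) (d : ℕ)
    (h : ∀ A : Finset W, A.card ≤ (A.biUnion t).card + d) :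
    ∃ R : W → W → Prop, (∀ a b, R a b → b ∈ t a) ∧ (∀ ⦃a b c⦄, R a c → R b c → a = b) ∧
      (univ.filter fun v => ∀ w, ¬ R v w).card ≤ d := by
  set t' : W → Finset (W ⊕ Fin d) := fun v => (t v).disjSum univ with ht'
  have hall : ∀ A : Finset W, A.card ≤ (A.biUnion t').card := by
    intro A
    rcases A.eq_empty_or_nonempty with rfl | ⟨a, ha⟩
    · simp
    have h1 : (A.biUnion t).disjSum (univ : Finset (Fin d)) ⊆ A.biUnion t' := by
      intro x hx
      rw [mem_biUnion]
      rcases mem_disjSum.1 hx with ⟨y, hy, rfl⟩ | ⟨y, hy, rfl⟩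
      · obtain ⟨b, hb, hyb⟩ := mem_biUnion.1 hy
        exact ⟨b, hb, inl_mem_disjSum.2 hyb⟩
      · exact ⟨a, ha, inr_mem_disjSum.2 hy⟩
    have h2 := card_le_card h1
    rw [card_disjSum, card_univ, Fintype.card_fin] at h2
    exact (h A).trans h2
  obtain ⟨g, hg, hgt⟩ := (all_card_le_biUnion_card_iff_exists_injective t').1 hall
  refine ⟨fun a b => g a = Sum.inl b, fun a b hab => ?_, fun a b c ha hb => hg (ha.trans hb.symm),
    ?_⟩
  · have := hgt a
    rw [show g a = Sum.inl b from hab] at this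
    exact inl_mem_disjSum.1 this
  · have h1 : (univ.filter fun v => ∀ w, ¬ g v = Sum.inl w).image g ⊆
        (univ : Finset (Fin d)).image Sum.inr := by
      intro x hx
      obtain ⟨v, hv, rfl⟩ := mem_image.1 hx
      simp only [mem_filter, mem_univ, true_and] at hv
      rcases hgv : g v with w | w
      · exact absurd hgv (hv w)
      · simp
    have h2 := card_le_card h1
    rw [card_image_of_injective _ hg] at h2
    refine le_trans (le_of_eq ?_) (h2.trans (card_image_le.trans (card_fin d).le))
    congr!

theorem val_lt_val_add_one {K : ℕ} [NeZero K] (a : ZMod K) (ha : a + 1 ≠ 0) :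
    a.val < (a + 1).val := by
  have hlt := ZMod.val_lt a
  by_contra hcon
  have h1 : a.val + 1 ≠ K := by
    intro h
    apply ha
    have : ((a.val + 1 : ℕ) : ZMod K) = 0 := by rw [h]; simp
    simpa using this
  have h2 : ((a.val + 1 : ℕ) : ZMod K) = a + 1 := by simp
  have h3 : (a + 1).val = a.val + 1 := by
    rw [← h2, ZMod.val_natCast, Nat.mod_eq_of_lt (by omega)]
  omega

/-- Hall's condition, up to a deficiency of `2 * card W / K`, between consecutive classes of
a balanced colouring. -/
theorem card_le_of_balanced {W : Type*} [Fintype W] {K : ℕ} [NeZero K]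
    (σ : ℕ → Equiv.Perm W) (f : W → ZMod K)
    (hf : ∑ v, ((∑ i ∈ range (K ^ 4),
        (if f (σ i v) = f v + 1 then (K : ℤ) - 1 else -1)) ^ 2 +
      (∑ i ∈ range (K ^ 4),
        (if f ((σ i).symm v) = f v + -1 then (K : ℤ) - 1 else -1)) ^ 2) ≤
      Fintype.card W * (2 * (K ^ 4 : ℕ) * (K : ℤ) ^ 2))
    (A T : Finset W)
    (hT : ∀ v ∈ A, ∀ i < K ^ 4, f (σ i v) = f v + 1 → σ i v ∈ T) :
    K * A.card ≤ K * T.card + 2 * Fintype.card W := by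
  have hK : (1 : ℤ) ≤ K := by exact_mod_cast Nat.one_le_iff_ne_zero.2 (NeZero.ne K)
  set Z : W → ℤ := fun v => ∑ i ∈ range (K ^ 4),
    (if f (σ i v) = f v + 1 then (K : ℤ) - 1 else -1) with hZ
  set Z' : W → ℤ := fun v => ∑ i ∈ range (K ^ 4),
    (if f ((σ i).symm v) = f v + -1 then (K : ℤ) - 1 else -1) with hZ'
  have key : ∀ i < K ^ 4,
      ∑ v ∈ A, ((if f (σ i v) = f v + 1 then (K : ℤ) - 1 else -1) + 1) ≤
      ∑ v ∈ T, ((if f ((σ i).symm v) = f v + -1 then (K : ℤ) - 1 else -1) + 1) := by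
    intro i hi
    have e1 : ∀ v, ((if f (σ i v) = f v + 1 then (K : ℤ) - 1 else -1) + 1) =
        if f (σ i v) = f v + 1 then (K : ℤ) else 0 := by
      intro v; split_ifs <;> ring
    have e2 : ∀ v, ((if f ((σ i).symm v) = f v + -1 then (K : ℤ) - 1 else -1) + 1) =
        if f ((σ i).symm v) = f v + -1 then (K : ℤ) else 0 := by
      intro v; split_ifs <;> ring
    simp only [e1, e2]
    rw [← sum_filter, ← sum_filter, sum_const, sum_const, nsmul_eq_mul, nsmul_eq_mul]
    refine mul_le_mul_of_nonneg_right ?_ (by omega)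
    have h1 : (A.filter fun v => f (σ i v) = f v + 1).image (σ i) ⊆
        T.filter fun v => f ((σ i).symm v) = f v + -1 := by
      intro w hw
      obtain ⟨v, hv, rfl⟩ := mem_image.1 hw
      rw [mem_filter] at hv ⊢
      refine ⟨hT v hv.1 i hi hv.2, ?_⟩
      rw [Equiv.symm_apply_apply, hv.2, add_neg_cancel_right]
    have h2 := card_le_card h1
    rw [card_image_of_injective _ (σ i).injective] at h2
    exact_mod_cast h2
  have hsum : ∑ v ∈ A, (Z v + (K : ℤ) ^ 4) ≤ ∑ v ∈ T, (Z' v + (K : ℤ) ^ 4) := by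
    have := sum_le_sum fun i (hi : i ∈ range (K ^ 4)) => key i (mem_range.1 hi)
    rw [sum_comm, sum_comm (t := T)] at this
    simpa only [sum_add_distrib, hZ, hZ', sum_const, card_range, nsmul_eq_mul, mul_one,
      Nat.cast_pow] using this
  have hq1 : ∑ v ∈ A, -(2 * (K : ℤ) ^ 3 * Z v) ≤ ∑ v, (Z v ^ 2 + ((K : ℤ) ^ 3) ^ 2) := by
    refine (sum_le_sum fun v _ => ?_).trans
      (sum_le_sum_of_subset_of_nonneg (subset_univ A) fun v _ _ => by positivity)
    nlinarith [sq_nonneg (Z v + (K : ℤ) ^ 3)]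
  have hq2 : ∑ v ∈ T, 2 * (K : ℤ) ^ 3 * Z' v ≤ ∑ v, (Z' v ^ 2 + ((K : ℤ) ^ 3) ^ 2) := by
    refine (sum_le_sum fun v _ => ?_).trans
      (sum_le_sum_of_subset_of_nonneg (subset_univ T) fun v _ _ => by positivity)
    nlinarith [sq_nonneg (Z' v - (K : ℤ) ^ 3)]
  rw [sum_neg_distrib, ← mul_sum] at hq1
  rw [← mul_sum] at hq2
  rw [sum_add_distrib, sum_const, card_univ, nsmul_eq_mul] at hq1 hq2
  replace hf : ∑ v, (Z v ^ 2 + Z' v ^ 2) ≤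
    Fintype.card W * (2 * (K ^ 4 : ℕ) * (K : ℤ) ^ 2) := hf
  rw [sum_add_distrib] at hf
  rw [sum_add_distrib, sum_add_distrib, sum_const, sum_const, nsmul_eq_mul, nsmul_eq_mul]
    at hsum
  push_cast at hf
  have hmul := mul_le_mul_of_nonneg_left hsum (by positivity : (0 : ℤ) ≤ 2 * (K : ℤ) ^ 3)
  have hfin : 2 * (K : ℤ) ^ 6 * (K * A.card) ≤
      2 * (K : ℤ) ^ 6 * (K * T.card + 2 * Fintype.card W) := by
    nlinarith
  have := le_of_mul_le_mul_left hfin (by positivity)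
  exact_mod_cast this

theorem exists_path_cover {W : Type*} [Fintype W] {K : ℕ} [NeZero K] (σ : ℕ → Equiv.Perm W)
    (hσ : ∀ i < K ^ 4, ∀ j < K ^ 4, i ≠ j → ∀ v, σ i v ≠ σ j v)
    (hσ' : ∀ i < K ^ 4, ∀ v, σ i v ≠ v) :
    ∃ Ps : List (List W),
      (∀ P ∈ Ps, P ≠ [] ∧ P.IsChain fun v w => ∃ i < K ^ 4, σ i v = w) ∧
      Ps.flatten.Nodup ∧ (∀ x, x ∈ Ps.flatten) ∧ K * Ps.length ≤ 3 * Fintype.card W := by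
  obtain ⟨f, hf⟩ := exists_balanced_colouring (K := K) (K ^ 4) σ hσ hσ'
  have hK : 0 < K := Nat.pos_of_ne_zero (NeZero.ne K)
  obtain ⟨c, hc⟩ : ∃ c : ZMod K, K * (univ.filter fun v => f v = c).card ≤ Fintype.card W := by
    have h1 : ∑ c : ZMod K, K * (univ.filter fun v => f v = c).card ≤
        ∑ c : ZMod K, Fintype.card W := by
      rw [← mul_sum, ← card_eq_sum_card_fiberwise (fun v _ => by simp), sum_const, card_univ,
        card_univ, ZMod.card, smul_eq_mul]
    obtain ⟨c, -, hc⟩ := exists_le_of_sum_le univ_nonempty h1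
    exact ⟨c, hc⟩
  set t : W → Finset W := fun v =>
    univ.filter fun w => f v ≠ c ∧ f w = f v + 1 ∧ ∃ i < K ^ 4, σ i v = w with ht
  obtain ⟨R, hRt, hR, hcard⟩ := exists_partial_matching t (3 * Fintype.card W / K) (by
    intro A
    have h1 := card_le_of_balanced σ f hf (A.filter fun v => ¬ f v = c) (A.biUnion t) (by
      intro v hv i hi hfi
      rw [mem_filter] at hv
      refine mem_biUnion.2 ⟨v, hv.1, ?_⟩
      simp only [ht, mem_filter, mem_univ, true_and]
      exact ⟨hv.2, hfi, i, hi, rfl⟩)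
    have h2 := card_filter_add_card_filter_not (s := A) (fun v => f v = c)
    have h3 : (A.filter fun v => f v = c).card ≤ (univ.filter fun v => f v = c).card :=
      card_le_card (filter_subset_filter _ (subset_univ A))
    have h4 := Nat.mul_le_mul_left K h3
    have h5 : K * A.card ≤ K * (A.biUnion t).card + 3 * Fintype.card W := by
      rw [← h2, mul_add]; omega
    rw [← Nat.sub_le_iff_le_add', Nat.le_div_iff_mul_le hK, mul_comm, Nat.mul_sub]
    omega)
  have hρ : ∀ ⦃a b⦄, R a b → (f a - c - 1).val < (f b - c - 1).val := by
    intro a b hab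
    have := hRt a b hab
    simp only [ht, mem_filter, mem_univ, true_and] at this
    have h1 : f b - c - 1 = (f a - c - 1) + 1 := by rw [this.2.1]; ring
    rw [h1]
    refine val_lt_val_add_one _ ?_
    rw [sub_add_cancel, sub_ne_zero]
    exact this.1
  obtain ⟨Ps, hP, hnd, hmem, -, hlen⟩ :=
    exists_path_cover_of_rank hR (fun v => (f v - c - 1).val) hρ univ
  refine ⟨Ps, fun P hPs => ⟨(hP P hPs).1, (hP P hPs).2.imp fun a b hab => ?_⟩, hnd,
    fun x => (hmem x).2 (mem_univ x), ?_⟩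
  · have := hRt a b hab
    simp only [ht, mem_filter, mem_univ, true_and] at this
    exact this.2.2
  · simp only [mem_univ, true_implies] at hlen
    rw [mul_comm, ← Nat.le_div_iff_mul_le hK]
    exact hlen.trans hcard

theorem Expander.hasDiHamCycle {V : Type*} [Fintype V] [Nonempty V] {G : V → V → Prop}
    {D d J K M T : ℕ} [NeZero K] (h : Expander G D d) (hG : ∀ v, ¬ G v v) (hD : 1 ≤ D)
    (hJ : Fintype.card V ≤ J * d) (hT : 1 ≤ T)
    (hd : (T + 1) * ((2 * J + 20) * (J + 1)) + K ^ 4 ≤ d) (hM : 3 * Fintype.card V ≤ K * M)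
    (hTM : (Fintype.card V : ℝ) ^ 2 * (1 - (D : ℝ) ^ 2 / (2 * (Fintype.card V : ℝ) ^ 2)) ^ T <
      (1 / 2) ^ M) :
    HasDiHamCycle G := by
  have hK : 0 < K := Nat.pos_of_ne_zero (NeZero.ne K)
  obtain ⟨Qs, hQ, hcyc, hQnd, hQlen, hcount⟩ := exists_absorbing_cycle h hJ hD T hT (by omega)
  set U := Qs.flatten.toFinset with hU
  have hUcard : U.card = Qs.flatten.length := List.toFinset_card_of_nodup hQnd
  obtain ⟨σ, hσ⟩ := h.exists_disjoint_perms U (K ^ 4) (by omega)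
  obtain ⟨Ps, hP, hPnd, hPmem, hPlen⟩ := exists_path_cover (K := K) σ
    (fun i hi j hj hij v => by
      rcases lt_or_gt_of_ne hij with hij | hij
      · exact ((hσ j hj v).2 i hij).symm
      · exact (hσ i hi v).2 j hij)
    (fun i hi v e => hG v (by simpa [e] using (hσ i hi v).1))
  have hflat : (Ps.map (List.map Subtype.val)).flatten = Ps.flatten.map Subtype.val :=
    List.map_flatten.symm
  obtain ⟨l, hl, hperm⟩ := exists_cyclicChain_absorbing (G := G)
    (Ps.map (List.map Subtype.val)) Qs hQ hcyc
    (by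
      rw [hflat, List.nodup_append']
      refine ⟨hQnd, hPnd.map Subtype.val_injective, fun x hx hx' => ?_⟩
      obtain ⟨y, -, rfl⟩ := List.mem_map.1 hx'
      exact y.2 (List.mem_toFinset.2 hx))
    (fun P hP' => by
      obtain ⟨P, hPs, rfl⟩ := List.mem_map.1 hP'
      refine ⟨fun e => (hP P hPs).1 (List.map_eq_nil_iff.1 e),
        (List.isChain_map _).2 ((hP P hPs).2.imp ?_)⟩
      rintro a _ ⟨i, hi, rfl⟩
      exact (hσ i hi a).1)
    (fun a b => by
      rw [List.length_map]
      have h1 : Ps.length ≤ M := by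
        have h2 : Fintype.card {v // v ∉ U} ≤ Fintype.card V := Fintype.card_subtype_le _
        exact Nat.le_of_mul_le_mul_left (hPlen.trans (by omega)) hK
      refine h1.trans ?_
      by_contra hcon
      have h3 := (hcount a b).trans_lt hTM
      exact absurd h3 (not_lt.2 (pow_le_pow_of_le_one (by norm_num) (by norm_num)
        (not_le.1 hcon).le)))
  have hmem : ∀ v, v ∈ l := by
    intro v
    rw [hperm.mem_iff, List.mem_append, hflat]
    by_cases hv : v ∈ U
    · exact Or.inl (List.mem_toFinset.1 hv)
    · exact Or.inr (List.mem_map.2 ⟨⟨v, hv⟩, hPmem _, rfl⟩)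
  refine hasDiHamCycle_of_isCyclicChain hl ?_ hmem ?_
  · rw [hperm.nodup_iff, hflat, List.nodup_append']
    refine ⟨hQnd, hPnd.map Subtype.val_injective, fun x hx hx' => ?_⟩
    obtain ⟨y, -, rfl⟩ := List.mem_map.1 hx'
    exact y.2 (List.mem_toFinset.2 hx)
  · exact List.ne_nil_of_mem (hmem (Classical.arbitrary V))

theorem eventually_mul_sq_lt_two_pow (K : ℕ) :
    ∀ᶠ M : ℕ in Filter.atTop, ((K : ℝ) * M) ^ 2 < 2 ^ M := by
  have h1 := tendsto_pow_const_div_const_pow_of_one_lt 2 (one_lt_two (α := ℝ))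
  have h2 := h1.eventually_lt_const (by positivity : (0 : ℝ) < 1 / ((K : ℝ) ^ 2 + 1))
  filter_upwards [h2] with M hM
  rw [div_lt_div_iff₀ (by positivity) (by positivity)] at hM
  nlinarith [sq_nonneg (M : ℝ)]

theorem exists_absorption_parameters (B : ℕ) (hB : 1 ≤ B) :
    ∃ K n₀ : ℕ, 1 ≤ K ∧ ∀ n ≥ n₀, ∃ d J M T : ℕ,
      1 ≤ n / B ∧ d ≤ n / B ∧ n * d ≤ n / B * (n / B) ∧ n ≤ J * d ∧ 1 ≤ T ∧
      (T + 1) * ((2 * J + 20) * (J + 1)) + K ^ 4 ≤ d ∧ 3 * n ≤ K * M ∧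
      (n : ℝ) ^ 2 * (1 - ((n / B + 1 : ℕ) : ℝ) ^ 2 / (2 * (n : ℝ) ^ 2)) ^ T < (1 / 2) ^ M := by
  have hB' : (1 : ℝ) ≤ B := by exact_mod_cast hB
  set p : ℝ := 1 - 1 / (2 * (B : ℝ) ^ 2) with hp
  have hp1 : p < 1 := by
    have : (0 : ℝ) < 1 / (2 * (B : ℝ) ^ 2) := by positivity
    linarith
  obtain ⟨A, hA⟩ := exists_pow_lt_of_lt_one (by norm_num : (0 : ℝ) < 1 / 4) hp1
  have hA1 : 1 ≤ A := by
    by_contra hcon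
    obtain rfl : A = 0 := by omega
    norm_num at hA
  set J := 8 * B ^ 2 with hJ
  set L := (2 * J + 20) * (J + 1) with hL
  have hL1 : 1 ≤ L := Nat.mul_pos (by omega) (by omega)
  set K := 200 * (A * L * B ^ 2) with hK
  have hB2 : 1 ≤ B ^ 2 := Nat.one_le_pow _ _ hB
  have hK1 : 1 ≤ K := by
    have : 1 ≤ A * L * B ^ 2 := Nat.mul_pos (Nat.mul_pos hA1 hL1) hB2
    omega
  obtain ⟨M₀, hM₀⟩ := Filter.eventually_atTop.1 (eventually_mul_sq_lt_two_pow K)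
  refine ⟨K, 8 * B ^ 2 + 2 * B + 16 * (B ^ 2 * (2 * (A * L) + K ^ 4)) + K * M₀, hK1,
    fun n hn => ⟨n / (4 * B ^ 2), J, 3 * n / K + 1, A * (3 * n / K + 1), ?_⟩⟩
  set e := n / B with he
  set d := n / (4 * B ^ 2) with hd
  set x := 3 * n / K with hx
  have he1 : B * e ≤ n := Nat.mul_div_le n B
  have he2 : n < B * (e + 1) := Nat.lt_mul_div_succ n (by omega)
  have hd1 : 4 * B ^ 2 * d ≤ n := Nat.mul_div_le n _
  have hd2 : n < 4 * B ^ 2 * (d + 1) := Nat.lt_mul_div_succ n (by omega)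
  have hx1 : K * x ≤ 3 * n := Nat.mul_div_le _ _
  have hx2 : 3 * n < K * (x + 1) := Nat.lt_mul_div_succ _ hK1
  have hn0 : 0 < n := by omega
  have he3 : n ≤ 2 * (B * e) := by
    rw [mul_add] at he2
    omega
  have hd3 : n ≤ J * d := by
    have : J * d = 2 * (4 * B ^ 2 * d) := by rw [hJ]; ring
    rw [mul_add] at hd2
    omega
  have hMx : M₀ ≤ x + 1 := by
    have : K * M₀ ≤ K * (x + 1) := by omega
    exact Nat.le_of_mul_le_mul_left this hK1
  refine ⟨?_, ?_, ?_, hd3, Nat.mul_pos hA1 (Nat.succ_pos x), ?_, hx2.le, ?_⟩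
  · rw [he, Nat.le_div_iff_mul_le (by omega)]; omega
  · exact Nat.div_le_div_left (by nlinarith) (by omega)
  · have h1 : 4 * B ^ 2 * (n * d) ≤ 4 * B ^ 2 * (e * e) := by nlinarith
    exact Nat.le_of_mul_le_mul_left h1 (by omega)
  · have h1 : 8 * B ^ 2 * ((A * (x + 1) + 1) * L + K ^ 4) ≤ 8 * B ^ 2 * d := by
      have h2 : (A * (x + 1) + 1) * L ≤ 2 * (A * L) * (x + 1) := by
        have : 1 * (1 * L) ≤ A * ((x + 1) * L) := by gcongr; exact Nat.succ_pos x
        nlinarith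
      have h3 : 8 * B ^ 2 * ((A * (x + 1) + 1) * L + K ^ 4) ≤
          8 * B ^ 2 * (2 * (A * L) * (x + 1) + K ^ 4) := by gcongr
      have h4 : 8 * B ^ 2 * (2 * (A * L) * (x + 1) + K ^ 4) =
          16 * (A * L * B ^ 2 * x) + 8 * (B ^ 2 * (2 * (A * L) + K ^ 4)) := by ring
      have h5 : K * x = 200 * (A * L * B ^ 2 * x) := by rw [hK]; ring
      have h6 : n ≤ 8 * B ^ 2 * d := hd3
      omega
    exact Nat.le_of_mul_le_mul_left h1 (by omega)
  · have hn' : (0 : ℝ) < n := by exact_mod_cast hn0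
    have he4 : e + 1 ≤ n + 1 := Nat.succ_le_succ (Nat.div_le_self _ _)
    have he2' : (n : ℝ) ≤ B * ((e + 1 : ℕ) : ℝ) := by exact_mod_cast he2.le
    have hq : 1 - ((e + 1 : ℕ) : ℝ) ^ 2 / (2 * (n : ℝ) ^ 2) ≤ p := by
      rw [hp]
      have : 1 / (2 * (B : ℝ) ^ 2) ≤ ((e + 1 : ℕ) : ℝ) ^ 2 / (2 * (n : ℝ) ^ 2) := by
        rw [div_le_div_iff₀ (by positivity) (by positivity)]
        nlinarith [mul_self_le_mul_self hn'.le he2']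
      linarith
    have hq0 : 0 ≤ 1 - ((e + 1 : ℕ) : ℝ) ^ 2 / (2 * (n : ℝ) ^ 2) := by
      have h1 : (8 : ℝ) ≤ n := by exact_mod_cast (by omega : 8 ≤ n)
      have h2 : ((e + 1 : ℕ) : ℝ) ≤ n + 1 := by exact_mod_cast he4
      have h3 : (0 : ℝ) ≤ ((e + 1 : ℕ) : ℝ) := Nat.cast_nonneg _
      rw [sub_nonneg, div_le_one (by positivity)]
      nlinarith
    have hnM : (n : ℝ) ^ 2 < 2 ^ (x + 1) := by
      refine lt_of_le_of_lt ?_ (hM₀ (x + 1) hMx)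
      gcongr
      exact_mod_cast (by omega : n ≤ K * (x + 1))
    have hpow : (1 - ((e + 1 : ℕ) : ℝ) ^ 2 / (2 * (n : ℝ) ^ 2)) ^ (A * (x + 1)) ≤
        (1 / 2) ^ (x + 1) * (1 / 2) ^ (x + 1) := by
      rw [pow_mul, ← mul_pow]
      refine pow_le_pow_left₀ (pow_nonneg hq0 _) ?_ _
      refine (pow_le_pow_left₀ hq0 hq _).trans (hA.le.trans (by norm_num))
    have h2M : (2 : ℝ) ^ (x + 1) * (1 / 2) ^ (x + 1) = 1 := by
      rw [← mul_pow]; norm_num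
    have hpos : (0 : ℝ) < (1 / 2) ^ (x + 1) := by positivity
    calc _ ≤ (n : ℝ) ^ 2 * ((1 / 2) ^ (x + 1) * (1 / 2) ^ (x + 1)) :=
          mul_le_mul_of_nonneg_left hpow (by positivity)
      _ < 2 ^ (x + 1) * ((1 / 2) ^ (x + 1) * (1 / 2) ^ (x + 1)) :=
          mul_lt_mul_of_pos_right hnM (by positivity)
      _ = (1 / 2) ^ (x + 1) := by rw [← mul_assoc, h2M, one_mul]

/-- **Approximate version of the Nash-Williams conjecture.** A sufficiently large
digraph whose out- and in-degree sequences satisfy the given Chvátal-type conditions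
with margin `ηn` contains a directed Hamilton cycle. Here `ep` (resp. `em`) is an
enumeration of the vertices with non-decreasing out-degrees (resp. in-degrees), so that
the `1`-indexed out-degree sequence is `d⁺_{i+1} = outDeg G (ep i)` for `i : Fin n`. -/
theorem approximate_nash_williams (η : ℝ) (hη0 : 0 < η) (hη1 : η < 1) :
    ∃ n₀ : ℕ, ∀ (V : Type) [Fintype V] (G : V → V → Prop),
      (∀ v : V, ¬ G v v) →
      n₀ ≤ Fintype.card V →
      ∀ (ep : Fin (Fintype.card V) ≃ V) (em : Fin (Fintype.card V) ≃ V),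
      Monotone (fun i : Fin (Fintype.card V) => outDeg G (ep i)) →
      Monotone (fun i : Fin (Fintype.card V) => inDeg G (em i)) →
      -- (i)  d⁺_i ≥ i + ηn  or  d⁻_{n−i−⌊ηn⌋} ≥ n − i,  for all 1 ≤ i < n/2
      (∀ i : Fin (Fintype.card V), 2 * ((i : ℕ) + 1) < Fintype.card V →
        ((((i : ℕ) + 1 : ℕ) : ℝ) + η * (Fintype.card V : ℝ) ≤ (outDeg G (ep i) : ℝ) ∨
          ∀ j : Fin (Fintype.card V),
            (j : ℕ) + 1 = Fintype.card V - ((i : ℕ) + 1) - ⌊η * (Fintype.card V : ℝ)⌋₊ →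
            (Fintype.card V : ℝ) - (((i : ℕ) + 1 : ℕ) : ℝ) ≤ (inDeg G (em j) : ℝ))) →
      -- (ii) d⁻_i ≥ i + ηn  or  d⁺_{n−i−⌊ηn⌋} ≥ n − i,  for all 1 ≤ i < n/2
      (∀ i : Fin (Fintype.card V), 2 * ((i : ℕ) + 1) < Fintype.card V →
        ((((i : ℕ) + 1 : ℕ) : ℝ) + η * (Fintype.card V : ℝ) ≤ (inDeg G (em i) : ℝ) ∨
          ∀ j : Fin (Fintype.card V),
            (j : ℕ) + 1 = Fintype.card V - ((i : ℕ) + 1) - ⌊η * (Fintype.card V : ℝ)⌋₊ →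
            (Fintype.card V : ℝ) - (((i : ℕ) + 1 : ℕ) : ℝ) ≤ (outDeg G (ep j) : ℝ))) →
      HasDiHamCycle G := by
  obtain ⟨B, hB⟩ := exists_nat_ge (4 / η + 16)
  have hB16 : (16 : ℝ) ≤ B := by
    have : 0 ≤ 4 / η := by positivity
    linarith
  have hBη : 4 ≤ η * B := by
    have : 4 / η ≤ B := by linarith
    rw [div_le_iff₀ hη0] at this
    linarith
  have hB16' : 16 ≤ B := by exact_mod_cast hB16
  obtain ⟨K, n₀, hK, hpar⟩ := exists_absorption_parameters B (by omega)
  obtain ⟨n₁, hn₁⟩ := exists_nat_ge (2 / (1 - η))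
  refine ⟨n₀ + n₁ + 3, fun V _ G hG hn ep em hep hem h₁ h₂ => ?_⟩
  obtain ⟨d, J, M, T, he, hde, hd, hJ, hT, hdT, hM, hTM⟩ :=
    hpar (Fintype.card V) (by omega)
  have : Nonempty V := Fintype.card_pos_iff.1 (by omega)
  have : NeZero K := ⟨by omega⟩
  have hBe : B * (Fintype.card V / B) ≤ Fintype.card V := Nat.mul_div_le _ _
  have hm4 : 4 * (4 * (Fintype.card V / B)) ≤ Fintype.card V := by nlinarith
  have hm : ((4 * (Fintype.card V / B) : ℕ) : ℝ) ≤ η * Fintype.card V := by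
    have h1 : (B : ℝ) * (Fintype.card V / B : ℕ) ≤ Fintype.card V := by exact_mod_cast hBe
    have h2 : (0 : ℝ) ≤ (Fintype.card V / B : ℕ) := Nat.cast_nonneg _
    have h3 := mul_le_mul_of_nonneg_left h1 hη0.le
    have h4 := mul_le_mul_of_nonneg_right hBη h2
    push_cast
    linarith
  have hη : η * Fintype.card V + 2 ≤ Fintype.card V := by
    have h1 : (n₁ : ℝ) ≤ Fintype.card V := by exact_mod_cast (by omega : n₁ ≤ Fintype.card V)
    have h2 := hn₁.trans h1
    rw [div_le_iff₀ (by linarith)] at h2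
    linarith
  have hexp := DegreeAlternative.expander
    (degreeAlternative_of_sequences (outDeg G) (inDeg G) η hη0 _ hm hm4 hη ep em hep hem h₁)
    (degreeAlternative_of_sequences (inDeg G) (outDeg G) η hη0 _ hm hm4 hη em ep hem hep h₂)
    (by omega) hG he hde hd
  exact hexp.hasDiHamCycle hG (by omega) hJ hT hdT hM hTM
end
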